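/- arXiv:2110.05244 — 3 statements merged into one kernel-verified Lean document; each statement's English description precedes it below -/
import Mathlib

section
/- Let 0 < α < 1, b > 0, J = [0,b]. Let ψ : J → ℝ be increasing and continuously differentiable with ψ'(z) > 0 for all z ∈ J, and let ϑ : J → ℝ be continuously differentiable. Then for every z ∈ J, I^{α,ψ}(N^{α,ψ}ϑ)(z) = ϑ(z) − ϑ(0). -/
open MeasureTheory Set

/-- ψ-Riemann–Liouville fractional integral of order `α` of `f` with respect to `ψ`
(with `ψ'` a given derivative function of `ψ`):
`I^{α,ψ} f (z) = (1/Γ(α)) ∫₀^z ψ'(κ) (ψ(z) - ψ(κ))^(α-1) f(κ) dκ`. -/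
noncomputable def psiInt (α : ℝ) (ψ ψ' f : ℝ → ℝ) (z : ℝ) : ℝ :=
  (1 / Real.Gamma α) * ∫ κ in (0:ℝ)..z, ψ' κ * (ψ z - ψ κ) ^ (α - 1) * f κ

/-- ψ-Caputo fractional derivative of order `α` (for `0 < α < 1`) of a function with
derivative `v'`, with respect to `ψ` (with derivative `ψ'`):
`N^{α,ψ} v (z) = (1/Γ(1-α)) ∫₀^z ψ'(κ) (ψ(z) - ψ(κ))^(-α) (v'(κ)/ψ'(κ)) dκ`. -/
noncomputable def psiCaputo (α : ℝ) (ψ ψ' v' : ℝ → ℝ) (z : ℝ) : ℝ :=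
  (1 / Real.Gamma (1 - α)) * ∫ κ in (0:ℝ)..z, ψ' κ * (ψ z - ψ κ) ^ (-α) * (v' κ / ψ' κ)

/-- Mittag-Leffler function `E_α(x) = ∑_{m=0}^∞ x^m / Γ(α m + 1)`. -/
noncomputable def mittagLeffler (α x : ℝ) : ℝ :=
  ∑' m : ℕ, x ^ m / Real.Gamma (α * m + 1)

/-- The Beta integral with exponents `-α` and `α - 1`, over an arbitrary interval. -/
theorem integral_sub_rpow_mul_sub_rpow {α a c : ℝ} (hα0 : 0 < α) (hα1 : α < 1) (hac : a < c) :
    ∫ x in a..c, (x - a) ^ (-α) * (c - x) ^ (α - 1) =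
      Real.Gamma (1 - α) * Real.Gamma α := by
  have hL : 0 < c - a := sub_pos.2 hac
  have hshift := intervalIntegral.integral_comp_sub_right (a := a) (b := c)
    (fun x : ℝ => x ^ (-α) * (c - a - x) ^ (α - 1)) a
  simp only [sub_sub_sub_cancel_right, sub_self] at hshift
  rw [hshift]
  have h := Complex.betaIntegral_scaled ((1 - α : ℝ) : ℂ) ((α : ℝ) : ℂ) hL
  rw [Complex.betaIntegral_eq_Gamma_mul_div _ _ (by simpa using hα1) (by simpa using hα0),
    Complex.Gamma_ofReal, Complex.Gamma_ofReal,
    show ((1 - α : ℝ) : ℂ) + (α : ℂ) = 1 by push_cast; ring, sub_self, Complex.cpow_zero,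
    Complex.Gamma_one, one_mul, div_one] at h
  have hcast : ∫ x in (0 : ℝ)..(c - a), ((x ^ (-α) * (c - a - x) ^ (α - 1) : ℝ) : ℂ) =
      ((Real.Gamma (1 - α) * Real.Gamma α : ℝ) : ℂ) := by
    rw [Complex.ofReal_mul, ← h]
    refine intervalIntegral.integral_congr fun x hx => ?_
    rw [uIcc_of_le hL.le] at hx
    rw [Complex.ofReal_mul, Complex.ofReal_cpow hx.1, Complex.ofReal_cpow (sub_nonneg.2 hx.2)]
    push_cast
    congr 2
    ring
  rw [intervalIntegral.integral_ofReal] at hcast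
  exact_mod_cast hcast

/-- The Beta integral of `integral_sub_rpow_mul_sub_rpow` after the substitution `x = ψ κ`. -/
theorem integral_deriv_mul_sub_rpow_mul_sub_rpow {α a c : ℝ} {ψ ψ' : ℝ → ℝ}
    (hα0 : 0 < α) (hα1 : α < 1) (hac : a < c) (hψ : ψ a < ψ c)
    (hcont : ContinuousOn ψ (Icc a c))
    (hderiv : ∀ x ∈ Ioo a c, HasDerivAt ψ (ψ' x) x) (hnonneg : ∀ x ∈ Ioo a c, 0 ≤ ψ' x) :
    ∫ κ in a..c, ψ' κ * ((ψ κ - ψ a) ^ (-α) * (ψ c - ψ κ) ^ (α - 1)) =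
      Real.Gamma (1 - α) * Real.Gamma α := by
  rw [← integral_sub_rpow_mul_sub_rpow hα0 hα1 hψ]
  exact intervalIntegral.integral_deriv_smul_comp_of_deriv_nonneg
    (g := fun x => (x - ψ a) ^ (-α) * (ψ c - x) ^ (α - 1))
    (by rwa [uIcc_of_le hac.le])
    (by rwa [min_eq_left hac.le, max_eq_right hac.le])
    (by rwa [min_eq_left hac.le, max_eq_right hac.le])

/-- Exchange of the order of integration over the triangle `0 < s < κ < z`, for a nonnegative
kernel with constant positive integral in `κ`. -/
theorem integral_integral_triangle_of_integral_eq_const {z C : ℝ} {k : ℝ → ℝ → ℝ} {f : ℝ → ℝ}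
    (hz : 0 ≤ z) (hC : 0 < C)
    (hk : AEMeasurable (Function.uncurry k)
      ((volume.restrict (Ioc 0 z)).prod (volume.restrict (Ioc 0 z))))
    (hk0 : ∀ s κ, 0 < s → s < κ → κ ≤ z → 0 ≤ k κ s)
    (hkC : ∀ s, 0 < s → s < z → ∫ κ in s..z, k κ s = C)
    (hf : IntervalIntegrable f volume 0 z) :
    ∫ κ in (0 : ℝ)..z, ∫ s in (0 : ℝ)..κ, k κ s * f s = C * ∫ s in (0 : ℝ)..z, f s := by
  have hfI : Integrable f (volume.restrict (Ioc 0 z)) :=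
    (intervalIntegrable_iff_integrableOn_Ioc_of_le hz).1 hf
  set μ := volume.restrict (Ioc 0 z) with hμ
  set T : Set (ℝ × ℝ) := {p | p.2 < p.1} with hT
  have hTm : MeasurableSet T := measurableSet_lt measurable_snd measurable_fst
  set F : ℝ × ℝ → ℝ := T.indicator fun p => k p.1 p.2 * f p.2 with hF
  have hFm : AEStronglyMeasurable F (μ.prod μ) :=
    ((hk.mul hfI.1.aemeasurable.comp_snd).indicator hTm).aestronglyMeasurable
  have hFs : ∀ s, (fun κ => F (κ, s)) = (Ioi s).indicator fun κ => k κ s * f s := fun s => by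
    ext κ; simp [hF, hT, indicator]
  have hFκ : ∀ κ, (fun s => F (κ, s)) = (Iio κ).indicator fun s => k κ s * f s := fun κ => by
    ext s; simp [hF, hT, indicator]
  have hset : ∀ s, 0 < s → Ioc 0 z ∩ Ioi s = Ioc s z := fun s hs => by
    ext κ; simp only [mem_inter_iff, mem_Ioc, mem_Ioi]; grind
  have hkint : ∀ s, 0 < s → s < z → IntegrableOn (fun κ => k κ s) (Ioc s z) := fun s hs hsz => by
    rw [← intervalIntegrable_iff_integrableOn_Ioc_of_le hsz.le]
    by_contra h
    have := hkC s hs hsz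
    rw [intervalIntegral.integral_undef h] at this
    exact hC.ne this
  have hae : ∀ᵐ s ∂μ, 0 < s ∧ s < z := by
    rw [hμ, ← restrict_Ioo_eq_restrict_Ioc]
    exact ae_restrict_mem measurableSet_Ioo
  have hFint : Integrable F (μ.prod μ) := by
    refine (integrable_prod_iff' hFm).2 ⟨?_, ?_⟩
    · filter_upwards [hae] with s hs
      rw [hFs, integrable_indicator_iff measurableSet_Ioi, IntegrableOn, hμ,
        Measure.restrict_restrict measurableSet_Ioi, inter_comm, hset s hs.1]
      exact (hkint s hs.1 hs.2).mul_const _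
    · refine (hfI.norm.const_mul C).congr ?_
      filter_upwards [hae] with s hs
      have hn : (fun κ => ‖F (κ, s)‖) = (Ioi s).indicator fun κ => ‖k κ s * f s‖ := by
        ext κ
        rw [congrFun (hFs s) κ, norm_indicator_eq_indicator_norm]
      rw [hn, hμ, setIntegral_indicator measurableSet_Ioi, hset s hs.1, ← hkC s hs.1 hs.2,
        intervalIntegral.integral_of_le hs.2.le, ← integral_mul_const]
      refine setIntegral_congr_fun measurableSet_Ioc fun κ hκ => ?_
      simp [abs_of_nonneg (hk0 s κ hs.1 hκ.1 hκ.2)]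
  have hleft : ∫ κ in (0 : ℝ)..z, ∫ s in (0 : ℝ)..κ, k κ s * f s =
      ∫ κ, ∫ s, F (κ, s) ∂μ ∂μ := by
    rw [intervalIntegral.integral_of_le hz]
    refine setIntegral_congr_fun measurableSet_Ioc fun κ hκ => ?_
    rw [hFκ, hμ, setIntegral_indicator measurableSet_Iio,
      intervalIntegral.integral_of_le hκ.1.le, integral_Ioc_eq_integral_Ioo]
    congr 2
    ext s; simp only [mem_inter_iff, mem_Ioc, mem_Iio, mem_Ioo]; grind
  rw [hleft, integral_integral_swap (f := fun κ s => F (κ, s)) hFint,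
    intervalIntegral.integral_of_le hz, ← integral_const_mul]
  refine integral_congr_ae ?_
  filter_upwards [hae] with s hs
  rw [hFs, hμ, setIntegral_indicator measurableSet_Ioi, hset s hs.1, integral_mul_const,
    ← intervalIntegral.integral_of_le hs.2.le, hkC s hs.1 hs.2]

/-- `I^{α,ψ} (N^{α,ψ} v) (z) = v(z) - v(0)` for a continuously differentiable `v`
(with derivative `v'` on `[0,b]`) and `0 < α < 1`. -/
theorem psiInt_psiCaputo (α b : ℝ) (hα0 : 0 < α) (hα1 : α < 1) (hb : 0 < b)
    (ψ ψ' v v' : ℝ → ℝ)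
    (hψ_mono : StrictMonoOn ψ (Set.Icc 0 b))
    (hψ_deriv : ∀ z ∈ Set.Icc 0 b, HasDerivWithinAt ψ (ψ' z) (Set.Icc 0 b) z)
    (hψ'_cont : ContinuousOn ψ' (Set.Icc 0 b))
    (hψ'_pos : ∀ z ∈ Set.Icc 0 b, 0 < ψ' z)
    (hv_deriv : ∀ z ∈ Set.Icc 0 b, HasDerivWithinAt v (v' z) (Set.Icc 0 b) z)
    (hv'_cont : ContinuousOn v' (Set.Icc 0 b)) :
    ∀ z ∈ Set.Icc 0 b,
      psiInt α ψ ψ' (fun w => psiCaputo α ψ ψ' v' w) z = v z - v 0 := by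
  intro z hz
  have hψ_cont : ContinuousOn ψ (Icc 0 b) := fun x hx => (hψ_deriv x hx).continuousWithinAt
  have hv_cont : ContinuousOn v (Icc 0 b) := fun x hx => (hv_deriv x hx).continuousWithinAt
  have hsub : Icc 0 z ⊆ Icc 0 b := Icc_subset_Icc_right hz.2
  have hΓα := Real.Gamma_pos_of_pos hα0
  have hΓβ := Real.Gamma_pos_of_pos (sub_pos.2 hα1)
  have hIoc : Ioc 0 z ⊆ Icc 0 b := Ioc_subset_Icc_self.trans hsub
  have hψ_meas : AEMeasurable ψ (volume.restrict (Ioc 0 z)) :=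
    (hψ_cont.mono hIoc).aemeasurable measurableSet_Ioc
  have hψ'_meas : AEMeasurable ψ' (volume.restrict (Ioc 0 z)) :=
    (hψ'_cont.mono hIoc).aemeasurable measurableSet_Ioc
  have hv'_int : IntervalIntegrable v' volume 0 z :=
    (hv'_cont.mono hsub).intervalIntegrable_of_Icc hz.1
  have hFTC : ∫ s in (0 : ℝ)..z, v' s = v z - v 0 :=
    intervalIntegral.integral_eq_sub_of_hasDerivAt_of_le hz.1 (hv_cont.mono hsub)
      (fun x hx => (hv_deriv x ⟨hx.1.le, hx.2.le.trans hz.2⟩).hasDerivAt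
        (Icc_mem_nhds hx.1 (hx.2.trans_le hz.2))) hv'_int
  have hswap := integral_integral_triangle_of_integral_eq_const (f := v')
    (k := fun κ s => ψ' κ * ((ψ κ - ψ s) ^ (-α) * (ψ z - ψ κ) ^ (α - 1)))
    hz.1 (mul_pos hΓβ hΓα)
    (hψ'_meas.comp_fst.mul (((hψ_meas.comp_fst.sub hψ_meas.comp_snd).pow_const _).mul
      ((hψ_meas.comp_fst.const_sub _).pow_const _)))
    (fun s κ hs hsκ hκz => by
      have hκ : κ ∈ Icc 0 b := ⟨(hs.trans hsκ).le, hκz.trans hz.2⟩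
      have h1 := hψ_mono.monotoneOn ⟨hs.le, hsκ.le.trans hκ.2⟩ hκ hsκ.le
      have h2 := hψ_mono.monotoneOn hκ hz hκz
      exact mul_nonneg (hψ'_pos κ hκ).le (mul_nonneg
        (Real.rpow_nonneg (sub_nonneg.2 h1) _) (Real.rpow_nonneg (sub_nonneg.2 h2) _)))
    (fun s hs hsz => integral_deriv_mul_sub_rpow_mul_sub_rpow hα0 hα1 hsz
      (hψ_mono ⟨hs.le, hsz.le.trans hz.2⟩ hz hsz)
      (hψ_cont.mono (Icc_subset_Icc hs.le hz.2))
      (fun x hx => (hψ_deriv x ⟨(hs.trans hx.1).le, hx.2.le.trans hz.2⟩).hasDerivAt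
        (Icc_mem_nhds (hs.trans hx.1) (hx.2.trans_le hz.2)))
      (fun x hx => (hψ'_pos x ⟨(hs.trans hx.1).le, hx.2.le.trans hz.2⟩).le))
    hv'_int
  rw [hFTC] at hswap
  have hmain : ∫ κ in (0 : ℝ)..z, ψ' κ * (ψ z - ψ κ) ^ (α - 1) * psiCaputo α ψ ψ' v' κ =
      (1 / Real.Gamma (1 - α)) * ∫ κ in (0 : ℝ)..z, ∫ s in (0 : ℝ)..κ,
        ψ' κ * ((ψ κ - ψ s) ^ (-α) * (ψ z - ψ κ) ^ (α - 1)) * v' s := by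
    rw [← intervalIntegral.integral_const_mul]
    refine intervalIntegral.integral_congr fun κ hκ => ?_
    rw [uIcc_of_le hz.1] at hκ
    simp only [psiCaputo]
    rw [mul_left_comm, ← intervalIntegral.integral_const_mul (ψ' κ * (ψ z - ψ κ) ^ (α - 1))]
    congr 1
    refine intervalIntegral.integral_congr fun s hs => ?_
    rw [uIcc_of_le hκ.1] at hs
    have := (hψ'_pos s ⟨hs.1, (hs.2.trans hκ.2).trans hz.2⟩).ne'
    field_simp
  rw [psiInt, hmain, hswap]
  field_simp
end

section
/- (Estimate on solutions.) Let 0 < α < 1, b > 0, J = [0,b]. Let ψ : J → ℝ be increasing and continuously differentiable with ψ'(z) > 0 for all z ∈ J. Let F : J × ℝ × ℝ → ℝ and H : J × J × ℝ → ℝ be continuous satisfying (Q1) |F(z, u₁, u₂) − F(z, v₁, v₂)| ≤ n(z)(|u₁ − v₁| + |u₂ − v₂|) and (Q2) |H(z, τ, u) − H(z, τ, v)| ≤ k(z)|u − v| for continuous n, k : J → ℝ. Set W₁ = sup_{z ∈ J} |n(z)|, W₂ = sup_{z ∈ J} |k(z)|, and W₃ = sup_{z ∈ J} |F(z, 0,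 (1/Γ(α)) ∫₀^z ψ'(τ)(ψ(z) − ψ(τ))^{α−1} H(z, τ, 0) dτ)|. If ϑ : J → ℝ is continuously differentiable, ϑ(0) = ϑ₀, and N^{α,ψ}ϑ(z) = F(z, ϑ(z), (1/Γ(α)) ∫₀^z ψ'(τ)(ψ(z) − ψ(τ))^{α−1} H(z, τ, N^{α,ψ}ϑ(τ)) dτ) for all z ∈ J, then for every z ∈ J, |ϑ(z)| ≤ [|ϑ₀| + ((ψ(b) − ψ(0))^α / Γ(α + 1))(W₃ + W₂|ϑ₀|)] · E_α(W₁(1 + W₂)(ψ(b) − ψ(0))^α). -/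
open MeasureTheory Set

theorem integral_rpow_mul_sub_rpow {s t a : ℝ} (hs : 0 < s) (ht : 0 < t) (ha : 0 < a) :
    ∫ x in (0:ℝ)..a, x ^ (s - 1) * (a - x) ^ (t - 1) =
      a ^ (s + t - 1) * (Real.Gamma s * Real.Gamma t / Real.Gamma (s + t)) := by
  have h := Complex.betaIntegral_scaled s t ha
  rw [Complex.betaIntegral_eq_Gamma_mul_div _ _ (by simpa) (by simpa), ← Complex.ofReal_add,
    Complex.Gamma_ofReal, Complex.Gamma_ofReal, Complex.Gamma_ofReal] at h
  have h2 : ∫ x in (0:ℝ)..a, (x : ℂ) ^ ((s : ℂ) - 1) * ((a : ℂ) - x) ^ ((t : ℂ) - 1) =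
      ((∫ x in (0:ℝ)..a, x ^ (s - 1) * (a - x) ^ (t - 1) : ℝ) : ℂ) := by
    rw [← intervalIntegral.integral_ofReal]
    refine intervalIntegral.integral_congr fun x hx => ?_
    rw [uIcc_of_le ha.le] at hx
    simp only [Complex.ofReal_mul]
    rw [Complex.ofReal_cpow hx.1, Complex.ofReal_cpow (sub_nonneg.2 hx.2)]
    push_cast
    rfl
  rw [h2] at h
  have h3 : ((a : ℂ)) ^ (((s + t : ℝ) : ℂ) - 1) = ((a ^ (s + t - 1) : ℝ) : ℂ) := by
    rw [Complex.ofReal_cpow ha.le]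
    push_cast
    rfl
  rw [h3] at h
  exact_mod_cast h

theorem rpow_mul_exp_neg_le_Gamma {s T : ℝ} (hs : 1 ≤ s) (hT : 0 < T) :
    T ^ (s - 1) * Real.exp (-T) ≤ Real.Gamma s := by
  rw [Real.Gamma_eq_integral (by linarith), ← integral_exp_neg_Ioi T, ← integral_const_mul]
  have hint := Real.GammaIntegral_convergent (show 0 < s by linarith)
  have hsub : Ioi T ⊆ Ioi 0 := Ioi_subset_Ioi hT.le
  calc _ ≤ ∫ x in Ioi T, Real.exp (-x) * x ^ (s - 1) := by
        refine setIntegral_mono_on ((integrableOn_exp_neg_Ioi T).const_mul _)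
          (hint.mono_set hsub) measurableSet_Ioi fun x hx => ?_
        rw [mul_comm]
        have hx' : T ≤ x := le_of_lt hx
        gcongr
    _ ≤ _ := by
        refine setIntegral_mono_set hint ?_ hsub.eventuallyLE
        filter_upwards [ae_restrict_mem measurableSet_Ioi] with x hx
        have : (0:ℝ) < x := hx
        simp only [Pi.zero_apply]
        positivity

theorem summable_mittagLeffler {α : ℝ} (hα : 0 < α) (x : ℝ) :
    Summable fun m : ℕ => x ^ m / Real.Gamma (α * m + 1) := by
  set T : ℝ := (2 * (|x| + 1)) ^ (1 / α) with hT
  have hx : 0 < 2 * (|x| + 1) := by positivity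
  have hTpos : 0 < T := by positivity
  have hTα : T ^ α = 2 * (|x| + 1) := by
    rw [hT, ← Real.rpow_mul hx.le, one_div_mul_cancel hα.ne', Real.rpow_one]
  refine Summable.of_norm_bounded
    ((summable_geometric_of_lt_one (r := |x| / T ^ α) (by positivity) ?_).mul_left (Real.exp T))
    fun m => ?_
  · rw [hTα, div_lt_one hx]
    linarith [abs_nonneg x]
  · have hm : 0 ≤ α * m := by positivity
    have h := rpow_mul_exp_neg_le_Gamma (s := α * m + 1) (by linarith) hTpos
    rw [add_sub_cancel_right, Real.rpow_mul hTpos.le, Real.rpow_natCast] at h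
    have hpos : 0 < (T ^ α) ^ m * Real.exp (-T) := by positivity
    rw [norm_div, norm_pow, Real.norm_eq_abs, Real.norm_eq_abs, abs_of_pos (hpos.trans_le h),
      div_pow]
    calc _ ≤ |x| ^ m / ((T ^ α) ^ m * Real.exp (-T)) := by gcongr
      _ = _ := by rw [Real.exp_neg]; field_simp

theorem mittagLeffler_mono {α x y : ℝ} (hα : 0 < α) (hx : 0 ≤ x) (hxy : x ≤ y) :
    mittagLeffler α x ≤ mittagLeffler α y := by
  refine (summable_mittagLeffler hα x).tsum_le_tsum (fun m => ?_) (summable_mittagLeffler hα y)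
  have : 0 < Real.Gamma (α * m + 1) := Real.Gamma_pos_of_pos (by positivity)
  gcongr

theorem mittagLeffler_nonneg {α x : ℝ} (hα : 0 < α) (hx : 0 ≤ x) : 0 ≤ mittagLeffler α x :=
  tsum_nonneg fun m => div_nonneg (pow_nonneg hx m) (Real.Gamma_pos_of_pos (by positivity)).le

theorem psiInt_of_nonneg {α : ℝ} {ψ ψ' f : ℝ → ℝ} {z : ℝ} (hz : 0 ≤ z) :
    psiInt α ψ ψ' f z =
      (1 / Real.Gamma α) * ∫ κ in Ioo 0 z, ψ' κ * (ψ z - ψ κ) ^ (α - 1) * f κ := by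
  rw [psiInt, intervalIntegral.integral_of_le hz, integral_Ioc_eq_integral_Ioo]

theorem psiInt_congr {α : ℝ} {ψ ψ' f φ φ' g : ℝ → ℝ} {z : ℝ} (hz : 0 ≤ z)
    (hψ : EqOn ψ φ (Icc 0 z)) (hψ' : EqOn ψ' φ' (Icc 0 z)) (hf : EqOn f g (Icc 0 z)) :
    psiInt α ψ ψ' f z = psiInt α φ φ' g z := by
  unfold psiInt
  congr 1
  refine intervalIntegral.integral_congr fun κ hκ => ?_
  rw [uIcc_of_le hz] at hκ
  simp only [hψ hκ, hψ' hκ, hf hκ, hψ (right_mem_Icc.2 hz)]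

theorem psiCaputo_eq_psiInt (α : ℝ) (ψ ψ' w : ℝ → ℝ) (z : ℝ) :
    psiCaputo α ψ ψ' w z = psiInt (1 - α) ψ ψ' (fun κ => w κ / ψ' κ) z := by
  rw [psiCaputo, psiInt, show 1 - α - 1 = -α by ring]

theorem measurable_psiInt {α : ℝ} {ψ ψ' f : ℝ → ℝ} (hψ : Measurable ψ) (hψ' : Measurable ψ')
    (hf : Measurable f) : Measurable (psiInt α ψ ψ' f) := by
  have hK : Measurable fun p : ℝ × ℝ => ψ' p.2 * (ψ p.1 - ψ p.2) ^ (α - 1) * f p.2 := by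
    fun_prop
  have key : ∀ S : Set (ℝ × ℝ), MeasurableSet S → Measurable fun z =>
      ∫ κ, S.indicator (fun p => ψ' p.2 * (ψ p.1 - ψ p.2) ^ (α - 1) * f p.2) (z, κ) := fun S hS =>
    (StronglyMeasurable.integral_prod_right' (ν := volume)
      (hK.indicator hS).stronglyMeasurable).measurable
  have h1 := key {p | 0 < p.2 ∧ p.2 ≤ p.1}
    ((measurableSet_lt measurable_const measurable_snd).inter
      (measurableSet_le measurable_snd measurable_fst))
  have h2 := key {p | p.1 < p.2 ∧ p.2 ≤ 0}
    ((measurableSet_lt measurable_fst measurable_snd).inter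
      (measurableSet_le measurable_snd measurable_const))
  convert! (h1.sub h2).const_mul (1 / Real.Gamma α) using 1
  funext z
  rw [psiInt, intervalIntegral, ← integral_indicator measurableSet_Ioc,
    ← integral_indicator measurableSet_Ioc]
  rfl

theorem setIntegral_beta_kernel {φ φ' : ℝ → ℝ} (hφ : ∀ x, HasDerivAt φ (φ' x) x)
    (hpos : ∀ x, 0 < φ' x) {α β κ z : ℝ} (hα : 0 < α) (hβ : 0 < β) (h : κ < z) :
    ∫ s in Ioo κ z, φ' s * (φ z - φ s) ^ (α - 1) * (φ s - φ κ) ^ (β - 1) =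
      (φ z - φ κ) ^ (α + β - 1) *
        (Real.Gamma α * Real.Gamma β / Real.Gamma (α + β)) := by
  have hmono : StrictMono φ := strictMono_of_hasDerivAt_pos hφ hpos
  have hcont : Continuous φ := continuous_iff_continuousAt.2 fun x => (hφ x).continuousAt
  have himg : φ '' Ioo κ z = Ioo (φ κ) (φ z) := by
    refine Subset.antisymm ?_ (intermediate_value_Ioo h.le hcont.continuousOn)
    rintro _ ⟨x, hx, rfl⟩
    exact ⟨hmono hx.1, hmono hx.2⟩
  have hcv := integral_image_eq_integral_abs_deriv_smul (s := Ioo κ z) measurableSet_Ioo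
    (fun x _ => (hφ x).hasDerivWithinAt) hmono.injective.injOn
    (fun y => (φ z - y) ^ (α - 1) * (y - φ κ) ^ (β - 1))
  have hshift := intervalIntegral.integral_comp_sub_right (a := φ κ) (b := φ z)
    (fun x => x ^ (β - 1) * (φ z - φ κ - x) ^ (α - 1)) (φ κ)
  rw [sub_self, integral_rpow_mul_sub_rpow hβ hα (sub_pos.2 (hmono h)),
    intervalIntegral.integral_of_le (hmono h).le, integral_Ioc_eq_integral_Ioo] at hshift
  calc _ = ∫ s in Ioo κ z, |φ' s| • ((φ z - φ s) ^ (α - 1) * (φ s - φ κ) ^ (β - 1)) := by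
        refine setIntegral_congr_fun measurableSet_Ioo fun x _ => ?_
        simp only [abs_of_pos (hpos x), smul_eq_mul, mul_assoc]
    _ = ∫ y in Ioo (φ κ) (φ z), (y - φ κ) ^ (β - 1) * (φ z - φ κ - (y - φ κ)) ^ (α - 1) := by
        rw [← hcv, himg]
        refine setIntegral_congr_fun measurableSet_Ioo fun x _ => ?_
        simp only [sub_sub_sub_cancel_right]
        ring
    _ = _ := by rw [hshift, add_comm β α, mul_comm (Real.Gamma β)]

theorem integrableOn_beta_kernel {φ φ' : ℝ → ℝ} (hφ : ∀ x, HasDerivAt φ (φ' x) x)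
    (hpos : ∀ x, 0 < φ' x) {α β κ z : ℝ} (hα : 0 < α) (hβ : 0 < β) :
    IntegrableOn (fun s => φ' s * (φ z - φ s) ^ (α - 1) * (φ s - φ κ) ^ (β - 1))
      (Ioo κ z) := by
  rcases le_or_gt z κ with h | h
  · simp [Ioo_eq_empty_of_le h]
  · refine Integrable.of_integral_ne_zero ?_
    rw [setIntegral_beta_kernel hφ hpos hα hβ h]
    have h1 := sub_pos.2 (strictMono_of_hasDerivAt_pos hφ hpos h)
    have h2 := Real.Gamma_pos_of_pos hα
    have h3 := Real.Gamma_pos_of_pos hβ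
    have h4 := Real.Gamma_pos_of_pos (add_pos hα hβ)
    positivity

theorem integrableOn_psiInt_kernel {φ φ' : ℝ → ℝ} (hφ : ∀ x, HasDerivAt φ (φ' x) x)
    (hpos : ∀ x, 0 < φ' x) {α z C : ℝ} {f : ℝ → ℝ} (hα : 0 < α) (hf : Measurable f)
    (hC : ∀ s ∈ Ioo 0 z, |f s| ≤ C) :
    IntegrableOn (fun s => φ' s * (φ z - φ s) ^ (α - 1) * f s) (Ioo 0 z) := by
  have h := integrableOn_beta_kernel hφ hpos (κ := 0) (z := z) hα one_pos
  simp only [sub_self, Real.rpow_zero, mul_one] at h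
  refine h.mul_bdd (c := C) hf.aestronglyMeasurable ?_
  filter_upwards [ae_restrict_mem measurableSet_Ioo] with s hs
  exact hC s hs

theorem psiInt_rpow {φ φ' : ℝ → ℝ} (hφ : ∀ x, HasDerivAt φ (φ' x) x)
    (hpos : ∀ x, 0 < φ' x) {α γ z : ℝ} (hα : 0 < α) (hγ : 0 ≤ γ) (hz : 0 ≤ z) :
    psiInt α φ φ' (fun s => (φ s - φ 0) ^ γ) z =
      Real.Gamma (γ + 1) / Real.Gamma (γ + α + 1) * (φ z - φ 0) ^ (γ + α) := by
  rcases hz.eq_or_lt with rfl | hz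
  · simp [psiInt, Real.zero_rpow (by positivity : γ + α ≠ 0)]
  · have h := setIntegral_beta_kernel hφ hpos hα (show 0 < γ + 1 by linarith) hz
    have := (Real.Gamma_pos_of_pos hα).ne'
    rw [add_sub_cancel_right] at h
    rw [psiInt_of_nonneg hz.le, h, show α + (γ + 1) = γ + α + 1 by ring, add_sub_cancel_right]
    field_simp

theorem psiInt_mono {φ φ' : ℝ → ℝ} (hφ : ∀ x, HasDerivAt φ (φ' x) x)
    (hpos : ∀ x, 0 < φ' x) {α z C C' : ℝ} {f g : ℝ → ℝ} (hα : 0 < α) (hz : 0 ≤ z)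
    (hf : Measurable f) (hg : Measurable g) (hC : ∀ s ∈ Ioo 0 z, |f s| ≤ C)
    (hC' : ∀ s ∈ Ioo 0 z, |g s| ≤ C') (hfg : ∀ s ∈ Ioo 0 z, f s ≤ g s) :
    psiInt α φ φ' f z ≤ psiInt α φ φ' g z := by
  rw [psiInt_of_nonneg hz, psiInt_of_nonneg hz]
  have := (Real.Gamma_pos_of_pos hα)
  refine mul_le_mul_of_nonneg_left ?_ (by positivity)
  refine setIntegral_mono_on (integrableOn_psiInt_kernel hφ hpos hα hf hC)
    (integrableOn_psiInt_kernel hφ hpos hα hg hC') measurableSet_Ioo fun s hs => ?_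
  refine mul_le_mul_of_nonneg_left (hfg s hs) (mul_nonneg (hpos s).le (Real.rpow_nonneg ?_ _))
  exact sub_nonneg.2 ((strictMono_of_hasDerivAt_pos hφ hpos).monotone hs.2.le)

theorem psiInt_add {φ φ' : ℝ → ℝ} (hφ : ∀ x, HasDerivAt φ (φ' x) x)
    (hpos : ∀ x, 0 < φ' x) {α z C C' : ℝ} {f g : ℝ → ℝ} (hα : 0 < α) (hz : 0 ≤ z)
    (hf : Measurable f) (hg : Measurable g) (hC : ∀ s ∈ Ioo 0 z, |f s| ≤ C)
    (hC' : ∀ s ∈ Ioo 0 z, |g s| ≤ C') :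
    psiInt α φ φ' (fun s => f s + g s) z = psiInt α φ φ' f z + psiInt α φ φ' g z := by
  simp only [psiInt_of_nonneg hz, mul_add]
  rw [integral_add (integrableOn_psiInt_kernel hφ hpos hα hf hC)
    (integrableOn_psiInt_kernel hφ hpos hα hg hC'), mul_add]

theorem psiInt_const_mul (α c z : ℝ) (φ φ' f : ℝ → ℝ) :
    psiInt α φ φ' (fun s => c * f s) z = c * psiInt α φ φ' f z := by
  simp only [psiInt, mul_left_comm _ c, intervalIntegral.integral_const_mul]

theorem psiInt_sum {φ φ' : ℝ → ℝ} (hφ : ∀ x, HasDerivAt φ (φ' x) x)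
    (hpos : ∀ x, 0 < φ' x) {ι : Type*} (S : Finset ι) {α z : ℝ} {f : ι → ℝ → ℝ} {C : ι → ℝ}
    (hα : 0 < α) (hz : 0 ≤ z) (hf : ∀ i, Measurable (f i))
    (hC : ∀ i, ∀ s ∈ Ioo 0 z, |f i s| ≤ C i) :
    psiInt α φ φ' (fun s => ∑ i ∈ S, f i s) z = ∑ i ∈ S, psiInt α φ φ' (f i) z := by
  simp only [psiInt_of_nonneg hz, Finset.mul_sum]
  rw [integral_finsetSum _ fun i _ => integrableOn_psiInt_kernel hφ hpos hα (hf i) (hC i),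
    Finset.mul_sum]

theorem psiInt_const {φ φ' : ℝ → ℝ} (hφ : ∀ x, HasDerivAt φ (φ' x) x)
    (hpos : ∀ x, 0 < φ' x) {α z : ℝ} (c : ℝ) (hα : 0 < α) (hz : 0 ≤ z) :
    psiInt α φ φ' (fun _ => c) z = c * ((φ z - φ 0) ^ α / Real.Gamma (α + 1)) := by
  have h := psiInt_rpow hφ hpos hα le_rfl hz
  have h2 := psiInt_const_mul α c z φ φ' (fun s => (φ s - φ 0) ^ (0:ℝ))
  simp only [Real.rpow_zero, mul_one, zero_add, Real.Gamma_one] at h h2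
  rw [h2, h]
  ring

theorem abs_psiInt_le {φ φ' : ℝ → ℝ} (hφ : ∀ x, HasDerivAt φ (φ' x) x)
    (hpos : ∀ x, 0 < φ' x) {α z C : ℝ} {f g : ℝ → ℝ} (hα : 0 < α) (hz : 0 ≤ z)
    (hf : Measurable f) (hg : Measurable g) (hC : ∀ s ∈ Ioo 0 z, |g s| ≤ C)
    (hfg : ∀ s ∈ Ioo 0 z, |f s| ≤ g s) :
    |psiInt α φ φ' f z| ≤ psiInt α φ φ' g z := by
  have hfC : ∀ s ∈ Ioo 0 z, |f s| ≤ C := fun s hs =>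
    (hfg s hs).trans ((le_abs_self _).trans (hC s hs))
  refine abs_le'.2 ⟨psiInt_mono hφ hpos hα hz hf hg hfC hC fun s hs => (abs_le'.1 (hfg s hs)).1,
    ?_⟩
  have h := psiInt_const_mul α (-1) z φ φ' f
  simp only [neg_one_mul] at h
  rw [← h]
  exact psiInt_mono hφ hpos hα hz hf.neg hg (by simpa using hfC) hC
    fun s hs => (abs_le'.1 (hfg s hs)).2

theorem abs_psiInt_le_of_le {φ φ' : ℝ → ℝ} (hφ : ∀ x, HasDerivAt φ (φ' x) x)
    (hpos : ∀ x, 0 < φ' x) {α z b C : ℝ} {f : ℝ → ℝ} (hα : 0 < α) (hz : 0 ≤ z) (hzb : z ≤ b)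
    (hC0 : 0 ≤ C) (hf : Measurable f) (hC : ∀ s ∈ Ioo 0 z, |f s| ≤ C) :
    |psiInt α φ φ' f z| ≤ C * ((φ b - φ 0) ^ α / Real.Gamma (α + 1)) := by
  have hmono := (strictMono_of_hasDerivAt_pos hφ hpos).monotone
  have h := abs_psiInt_le hφ hpos hα hz hf (measurable_const (a := C)) (C := C)
    (fun _ _ => (abs_of_nonneg hC0).le) hC
  rw [psiInt_const hφ hpos C hα hz] at h
  have h0 : 0 ≤ φ z - φ 0 := sub_nonneg.2 (hmono hz)
  have h1 := hmono hzb
  have h2 : 0 < Real.Gamma (α + 1) := Real.Gamma_pos_of_pos (by linarith)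
  exact h.trans (by gcongr)

theorem psiInt_psiInt_one_sub {φ φ' : ℝ → ℝ} (hφ : ∀ x, HasDerivAt φ (φ' x) x)
    (hpos : ∀ x, 0 < φ' x) (hφ' : Continuous φ') {α z : ℝ} {g : ℝ → ℝ} (hα0 : 0 < α)
    (hα1 : α < 1) (hz : 0 ≤ z) (hg : Continuous g) :
    psiInt α φ φ' (psiInt (1 - α) φ φ' g) z = ∫ κ in Ioo 0 z, φ' κ * g κ := by
  have hmono : StrictMono φ := strictMono_of_hasDerivAt_pos hφ hpos
  have hcont : Continuous φ := continuous_iff_continuousAt.2 fun x => (hφ x).continuousAt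
  have hα' : 0 < 1 - α := sub_pos.2 hα1
  have hΓ := Real.Gamma_pos_of_pos hα0
  have hΓ' := Real.Gamma_pos_of_pos hα'
  set k : ℝ → ℝ → ℝ := fun s κ => φ' s * (φ z - φ s) ^ (α - 1) * (φ s - φ κ) ^ (1 - α - 1)
    with hk
  set S : Set (ℝ × ℝ) := {p | p.2 < p.1} with hS
  set f : ℝ × ℝ → ℝ := S.indicator fun p => k p.1 p.2 * (φ' p.2 * g p.2) with hf
  have hSm : MeasurableSet S := measurableSet_lt measurable_snd measurable_fst
  have hfm : Measurable f := by
    refine Measurable.indicator ?_ hSm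
    simp only [hk]
    have := hcont.measurable
    have := hφ'.measurable
    have := hg.measurable
    fun_prop
  have hf_fst : ∀ s κ, f (s, κ) = (Iio s).indicator (fun κ => k s κ * (φ' κ * g κ)) κ :=
    fun s κ => rfl
  have hf_snd : ∀ s κ, f (s, κ) = (Ioi κ).indicator (fun s => k s κ * (φ' κ * g κ)) s :=
    fun s κ => rfl
  have hinter : ∀ κ ∈ Ioo 0 z, Ioo 0 z ∩ Ioi κ = Ioo κ z := fun κ hκ => by
    ext x
    simp only [mem_inter_iff, mem_Ioo, mem_Ioi]
    exact ⟨fun h => ⟨h.2, h.1.2⟩, fun h => ⟨⟨hκ.1.trans h.1, h.2⟩, h.1⟩⟩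
  have hk_int : ∀ κ ∈ Ioo 0 z, ∫ s in Ioo κ z, k s κ = Real.Gamma α * Real.Gamma (1 - α) :=
    fun κ hκ => by
      rw [setIntegral_beta_kernel hφ hpos hα0 hα' hκ.2]
      simp
  have hk_nonneg : ∀ κ, ∀ s ∈ Ioo κ z, 0 ≤ k s κ := fun κ s hs =>
    mul_nonneg (mul_nonneg (hpos s).le (Real.rpow_nonneg (sub_pos.2 (hmono hs.2)).le _))
      (Real.rpow_nonneg (sub_pos.2 (hmono hs.1)).le _)
  have hint : Integrable f ((volume.restrict (Ioo 0 z)).prod (volume.restrict (Ioo 0 z))) := by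
    refine (integrable_prod_iff' hfm.aestronglyMeasurable).2 ⟨?_, ?_⟩
    · filter_upwards [ae_restrict_mem measurableSet_Ioo] with κ hκ
      simp only [hf_snd]
      rw [integrable_indicator_iff measurableSet_Ioi, IntegrableOn,
        Measure.restrict_restrict measurableSet_Ioi, inter_comm, hinter κ hκ]
      exact (integrableOn_beta_kernel hφ hpos hα0 hα').mul_const _
    · have hc : Continuous fun κ => Real.Gamma α * Real.Gamma (1 - α) * |φ' κ * g κ| := by
        fun_prop
      refine ((hc.integrableOn_Icc (a := 0) (b := z)).mono_set Ioo_subset_Icc_self).congr ?_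
      filter_upwards [ae_restrict_mem measurableSet_Ioo] with κ hκ
      simp only [hf_snd, norm_indicator_eq_indicator_norm]
      rw [setIntegral_indicator measurableSet_Ioi, hinter κ hκ, ← hk_int κ hκ,
        ← integral_mul_const]
      refine setIntegral_congr_fun measurableSet_Ioo fun s hs => ?_
      simp only [norm_mul, Real.norm_eq_abs, abs_mul, abs_of_nonneg (hk_nonneg κ s hs)]
  have hswap := integral_integral_swap (f := fun s κ => f (s, κ)) hint
  have hl : ∫ s in Ioo 0 z, ∫ κ in Ioo 0 z, f (s, κ) =
      Real.Gamma α * Real.Gamma (1 - α) *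
        psiInt α φ φ' (psiInt (1 - α) φ φ' g) z := by
    rw [psiInt_of_nonneg hz, ← mul_assoc, ← integral_const_mul]
    refine setIntegral_congr_fun measurableSet_Ioo fun s hs => ?_
    simp only [hf_fst]
    have : Ioo 0 z ∩ Iio s = Ioo 0 s := by
      ext x
      simp only [mem_inter_iff, mem_Ioo, mem_Iio]
      exact ⟨fun h => ⟨h.1.1, h.2⟩, fun h => ⟨⟨h.1, h.2.trans hs.2⟩, h.2⟩⟩
    rw [setIntegral_indicator measurableSet_Iio, this, psiInt_of_nonneg hs.1.le]
    have h2 : ∀ κ, k s κ * (φ' κ * g κ) = φ' s * (φ z - φ s) ^ (α - 1) *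
        (φ' κ * (φ s - φ κ) ^ (1 - α - 1) * g κ) := fun κ => by simp only [hk]; ring
    simp only [h2, integral_const_mul]
    field_simp
  have hr : ∫ κ in Ioo 0 z, ∫ s in Ioo 0 z, f (s, κ) =
      Real.Gamma α * Real.Gamma (1 - α) * ∫ κ in Ioo 0 z, φ' κ * g κ := by
    rw [← integral_const_mul]
    refine setIntegral_congr_fun measurableSet_Ioo fun κ hκ => ?_
    simp only [hf_snd]
    rw [setIntegral_indicator measurableSet_Ioi, hinter κ hκ, integral_mul_const, hk_int κ hκ]
  rw [hl, hr] at hswap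
  exact mul_left_cancel₀ (by positivity) hswap

theorem exists_abs_le_of_continuous {g : ℝ → ℝ} (hg : Continuous g) (z : ℝ) :
    ∃ C, ∀ s ∈ Ioo 0 z, |g s| ≤ C := by
  obtain ⟨C, hC⟩ := (isCompact_Icc (a := 0) (b := z)).exists_bound_of_continuousOn hg.continuousOn
  exact ⟨C, fun s hs => hC s (Ioo_subset_Icc_self hs)⟩

/-- Grönwall inequality for the `ψ`-Riemann–Liouville fractional integral. -/
theorem le_mul_mittagLeffler_of_le_add_psiInt {φ φ' : ℝ → ℝ}
    (hφ : ∀ x, HasDerivAt φ (φ' x) x) (hpos : ∀ x, 0 < φ' x) {α b A L M : ℝ} {e : ℝ → ℝ}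
    (hα : 0 < α) (hL : 0 ≤ L) (he : Measurable e) (hM : ∀ z ∈ Icc 0 b, |e z| ≤ M)
    (hle : ∀ z ∈ Icc 0 b, e z ≤ A + L * psiInt α φ φ' e z) {z : ℝ} (hz : z ∈ Icc 0 b) :
    e z ≤ A * mittagLeffler α (L * (φ z - φ 0) ^ α) := by
  have hmono : StrictMono φ := strictMono_of_hasDerivAt_pos hφ hpos
  have hcont : Continuous φ := continuous_iff_continuousAt.2 fun x => (hφ x).continuousAt
  set p : ℕ → ℝ → ℝ := fun m s => L ^ m / Real.Gamma (α * m + 1) * (φ s - φ 0) ^ (α * m)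
    with hp
  have hpc : ∀ m, Continuous (p m) := fun m =>
    continuous_const.mul ((hcont.sub continuous_const).rpow_const fun _ => Or.inr (by positivity))
  have hp0 : ∀ s, p 0 s = 1 := fun s => by simp [hp]
  have hpsucc : ∀ m, ∀ z ∈ Icc 0 b, L * psiInt α φ φ' (p m) z = p (m + 1) z := fun m z hz => by
    have h := psiInt_rpow hφ hpos (γ := α * m) hα (by positivity) hz.1
    have hΓ := (Real.Gamma_pos_of_pos (show 0 < α * m + 1 by positivity)).ne'
    simp only [hp]
    rw [psiInt_const_mul, h, show α * m + α = α * ((m + 1 : ℕ) : ℝ) by push_cast; ring]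
    field_simp
    ring
  have key : ∀ N : ℕ, ∀ z ∈ Icc 0 b,
      e z ≤ A * ∑ m ∈ Finset.range N, p m z + M * p N z := by
    intro N
    induction N with
    | zero => exact fun z hz => by simpa [hp0] using (le_abs_self _).trans (hM z hz)
    | succ N ih =>
      intro z hz
      have hsub : ∀ s ∈ Ioo 0 z, s ∈ Icc 0 b := fun s hs => ⟨hs.1.le, hs.2.le.trans hz.2⟩
      have hsum : Continuous fun s => ∑ m ∈ Finset.range N, p m s :=
        continuous_finsetSum _ fun m _ => hpc m
      have hc1 : Continuous fun s => A * ∑ m ∈ Finset.range N, p m s := by fun_prop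
      have hc2 : Continuous fun s => M * p N s := continuous_const.mul (hpc N)
      obtain ⟨C, hC⟩ := exists_abs_le_of_continuous (hc1.add hc2) z
      obtain ⟨C₁, hC₁⟩ := exists_abs_le_of_continuous hc1 z
      obtain ⟨C₂, hC₂⟩ := exists_abs_le_of_continuous hc2 z
      choose D hD using fun m => exists_abs_le_of_continuous (hpc m) z
      have h1 := psiInt_mono hφ hpos hα hz.1 he (hc1.add hc2).measurable
        (fun s hs => hM s (hsub s hs)) hC fun s hs => ih s (hsub s hs)
      have h2 := psiInt_add hφ hpos hα hz.1 hc1.measurable hc2.measurable hC₁ hC₂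
      rw [psiInt_const_mul, psiInt_const_mul,
        psiInt_sum hφ hpos _ hα hz.1 (fun m => (hpc m).measurable) hD] at h2
      calc e z ≤ A + L * psiInt α φ φ' e z := hle z hz
        _ ≤ A + L * (A * ∑ m ∈ Finset.range N, psiInt α φ φ' (p m) z +
              M * psiInt α φ φ' (p N) z) := by
            rw [← h2]
            gcongr
            exact h1
        _ = A * (∑ m ∈ Finset.range N, L * psiInt α φ φ' (p m) z + 1) +
              M * (L * psiInt α φ φ' (p N) z) := by rw [← Finset.mul_sum]; ring
        _ = _ := by
            rw [Finset.sum_range_succ', hp0, hpsucc N z hz,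
              Finset.sum_congr rfl fun m _ => hpsucc m z hz]
  have hterm : ∀ m, p m z = (L * (φ z - φ 0) ^ α) ^ m / Real.Gamma (α * m + 1) := fun m => by
    simp only [hp]
    rw [mul_pow, Real.rpow_mul (sub_nonneg.2 (hmono.monotone hz.1)), Real.rpow_natCast]
    ring
  have hsum := summable_mittagLeffler hα (L * (φ z - φ 0) ^ α)
  have hlim := (hsum.hasSum.tendsto_sum_nat.const_mul A).add
    (hsum.tendsto_atTop_zero.const_mul M)
  rw [mul_zero, add_zero] at hlim
  refine ge_of_tendsto' hlim fun N => ?_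
  simpa only [hterm] using key N z hz

theorem exists_hasDerivAt_extension {b : ℝ} (hb : 0 < b) {ψ ψ' : ℝ → ℝ}
    (hψ : ∀ z ∈ Icc 0 b, HasDerivWithinAt ψ (ψ' z) (Icc 0 b) z)
    (hψ' : ContinuousOn ψ' (Icc 0 b)) (hpos : ∀ z ∈ Icc 0 b, 0 < ψ' z) :
    ∃ φ φ' : ℝ → ℝ, (∀ x, HasDerivAt φ (φ' x) x) ∧ Continuous φ' ∧ (∀ x, 0 < φ' x) ∧
      EqOn ψ φ (Icc 0 b) ∧ EqOn ψ' φ' (Icc 0 b) := by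
  set φ' : ℝ → ℝ := IccExtend hb.le ((Icc 0 b).domRestrict ψ') with hφ'
  have hc : Continuous φ' := continuousOn_iff_continuous_domRestrict.1 hψ' |>.Icc_extend'
  have heq : EqOn ψ' φ' (Icc 0 b) := fun x hx => by rw [hφ', IccExtend_of_mem _ _ hx]; rfl
  refine ⟨fun x => ψ 0 + ∫ t in (0:ℝ)..x, φ' t, φ', fun x => ?_, hc,
    fun x => hpos _ (projIcc 0 b hb.le x).2, fun x hx => ?_, heq⟩
  · exact (hc.integral_hasStrictDerivAt 0 x).hasDerivAt.const_add _
  · have hsub : Icc 0 x ⊆ Icc 0 b := Icc_subset_Icc_right hx.2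
    have h := intervalIntegral.integral_eq_sub_of_hasDerivAt_of_le hx.1
      (f := ψ) (f' := φ') (fun y hy => (hψ y (hsub hy)).continuousWithinAt.mono hsub)
      (fun y hy => ?_) (hc.intervalIntegrable _ _)
    · simp only [h]
      ring
    · have hy' : y ∈ Ioo 0 b := ⟨hy.1, hy.2.trans_le hx.2⟩
      rw [← heq (Ioo_subset_Icc_self hy')]
      exact (hψ y (Ioo_subset_Icc_self hy')).hasDerivAt (Icc_mem_nhds hy'.1 hy'.2)

/-- Estimate on solutions of the ψ-Caputo fractional integro-differential problem:
`|v(z)| ≤ [|v₀| + ((ψ(b)-ψ(0))^α / Γ(α+1))(W₃ + W₂|v₀|)] · E_α(W₁(1+W₂)(ψ(b)-ψ(0))^α)`. -/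
theorem caputo_solution_estimate (α b : ℝ) (hα0 : 0 < α) (hα1 : α < 1) (hb : 0 < b)
    (ψ ψ' : ℝ → ℝ)
    (hψ_mono : StrictMonoOn ψ (Set.Icc 0 b))
    (hψ_deriv : ∀ z ∈ Set.Icc 0 b, HasDerivWithinAt ψ (ψ' z) (Set.Icc 0 b) z)
    (hψ'_cont : ContinuousOn ψ' (Set.Icc 0 b))
    (hψ'_pos : ∀ z ∈ Set.Icc 0 b, 0 < ψ' z)
    (F : ℝ → ℝ → ℝ → ℝ) (H : ℝ → ℝ → ℝ → ℝ)
    (hF_cont : ContinuousOn (fun p : ℝ × ℝ × ℝ => F p.1 p.2.1 p.2.2)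
      (Set.Icc 0 b ×ˢ (Set.univ : Set ℝ) ×ˢ (Set.univ : Set ℝ)))
    (hH_cont : ContinuousOn (fun p : ℝ × ℝ × ℝ => H p.1 p.2.1 p.2.2)
      (Set.Icc 0 b ×ˢ Set.Icc 0 b ×ˢ (Set.univ : Set ℝ)))
    (n k : ℝ → ℝ)
    (hn_cont : ContinuousOn n (Set.Icc 0 b))
    (hk_cont : ContinuousOn k (Set.Icc 0 b))
    (hQ1 : ∀ z ∈ Set.Icc 0 b, ∀ u₁ u₂ w₁ w₂ : ℝ,
      |F z u₁ u₂ - F z w₁ w₂| ≤ n z * (|u₁ - w₁| + |u₂ - w₂|))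
    (hQ2 : ∀ z ∈ Set.Icc 0 b, ∀ τ ∈ Set.Icc 0 b, ∀ u w : ℝ,
      |H z τ u - H z τ w| ≤ k z * |u - w|)
    (W₁ W₂ W₃ : ℝ)
    (hW₁ : W₁ = sSup ((fun z => |n z|) '' Set.Icc 0 b))
    (hW₂ : W₂ = sSup ((fun z => |k z|) '' Set.Icc 0 b))
    (hW₃ : W₃ = sSup ((fun z =>
      |F z 0 (psiInt α ψ ψ' (fun τ => H z τ 0) z)|) '' Set.Icc 0 b))
    (v₀ : ℝ) (v v' : ℝ → ℝ)
    (hv_deriv : ∀ z ∈ Set.Icc 0 b, HasDerivWithinAt v (v' z) (Set.Icc 0 b) z)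
    (hv'_cont : ContinuousOn v' (Set.Icc 0 b))
    (hv0 : v 0 = v₀)
    (hsol : ∀ z ∈ Set.Icc 0 b,
      psiCaputo α ψ ψ' v' z =
        F z (v z) (psiInt α ψ ψ' (fun τ => H z τ (psiCaputo α ψ ψ' v' τ)) z)) :
    ∀ z ∈ Set.Icc 0 b,
      |v z| ≤ (|v₀| + (ψ b - ψ 0) ^ α / Real.Gamma (α + 1) * (W₃ + W₂ * |v₀|)) *
        mittagLeffler α (W₁ * (1 + W₂) * (ψ b - ψ 0) ^ α) := by
  obtain ⟨φ, φ', hφ, hφ'c, hpos, hψφ, hψφ'⟩ :=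
    exists_hasDerivAt_extension hb hψ_deriv hψ'_cont hψ'_pos
  have hmono : StrictMono φ := strictMono_of_hasDerivAt_pos hφ hpos
  have hφm : Measurable φ := hmono.monotone.measurable
  have hφ'm : Measurable φ' := hφ'c.measurable
  have hα' : 0 < 1 - α := sub_pos.2 hα1
  have h0b : (0:ℝ) ∈ Icc 0 b := left_mem_Icc.2 hb.le
  have hbb : b ∈ Icc 0 b := right_mem_Icc.2 hb.le
  have hsub : ∀ z ∈ Icc 0 b, Icc 0 z ⊆ Icc 0 b := fun z hz => Icc_subset_Icc_right hz.2
  have hsub' : ∀ z ∈ Icc 0 b, ∀ s ∈ Ioo 0 z, s ∈ Icc 0 b := fun z hz s hs =>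
    hsub z hz (Ioo_subset_Icc_self hs)
  have htransfer : ∀ {β : ℝ} {f g : ℝ → ℝ} {z : ℝ}, z ∈ Icc 0 b → EqOn f g (Icc 0 b) →
      psiInt β ψ ψ' f z = psiInt β φ φ' g z := fun hz hfg =>
    psiInt_congr hz.1 (hψφ.mono (hsub _ hz)) (hψφ'.mono (hsub _ hz)) (hfg.mono (hsub _ hz))
  -- The fractional derivative, extended to a bounded measurable function on the line.
  have hgc : ContinuousOn (fun κ => v' κ / ψ' κ) (Icc 0 b) :=
    hv'_cont.div hψ'_cont fun x hx => (hψ'_pos x hx).ne'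
  set g : ℝ → ℝ := IccExtend hb.le ((Icc 0 b).domRestrict fun κ => v' κ / ψ' κ) with hg
  have hgcont : Continuous g := (continuousOn_iff_continuous_domRestrict.1 hgc).Icc_extend'
  have hgeq : EqOn (fun κ => v' κ / ψ' κ) g (Icc 0 b) := fun x hx => by
    rw [hg, IccExtend_of_mem _ _ hx]; rfl
  set D : ℝ → ℝ := psiInt (1 - α) φ φ' g with hD
  have hDeq : EqOn (psiCaputo α ψ ψ' v') D (Icc 0 b) := fun z hz => by
    rw [psiCaputo_eq_psiInt, hD, htransfer hz hgeq]
  have hDm : Measurable D := measurable_psiInt hφm hφ'm hgcont.measurable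
  obtain ⟨CD, hCD0, hCD⟩ : ∃ C, 0 ≤ C ∧ ∀ z ∈ Icc 0 b, |D z| ≤ C := by
    obtain ⟨C, hC⟩ := (isCompact_Icc (a := 0) (b := b)).exists_bound_of_continuousOn
      hgcont.continuousOn
    have hC0 : 0 ≤ C := (norm_nonneg _).trans (hC 0 h0b)
    have hb' := abs_psiInt_le_of_le hφ hpos hα' h0b.1 hb.le hC0 hgcont.measurable
      (by simp)
    exact ⟨_, (abs_nonneg _).trans hb', fun z hz => abs_psiInt_le_of_le hφ hpos hα' hz.1 hz.2 hC0
      hgcont.measurable fun s hs => hC s (hsub' z hz s hs)⟩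
  have hvD : ∀ z ∈ Icc 0 b, v z = v₀ + psiInt α φ φ' D z := fun z hz => by
    have hcongr : ∫ κ in Ioo 0 z, φ' κ * g κ = ∫ κ in Ioo 0 z, v' κ :=
      setIntegral_congr_fun measurableSet_Ioo fun κ hκ => by
        have hκ' := hsub' z hz κ hκ
        simp only [← hgeq hκ', ← hψφ' hκ']
        exact mul_div_cancel₀ _ (hψ'_pos κ hκ').ne'
    have hftc := intervalIntegral.integral_eq_sub_of_hasDerivAt_of_le hz.1 (f := v) (f' := v')
      (fun y hy => (hv_deriv y (hsub z hz hy)).continuousWithinAt.mono (hsub z hz))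
      (fun y hy => (hv_deriv y (hsub' z hz y hy)).hasDerivAt
        (Icc_mem_nhds hy.1 (hy.2.trans_le hz.2)))
      ((hv'_cont.mono (hsub z hz)).intervalIntegrable_of_Icc hz.1)
    rw [intervalIntegral.integral_of_le hz.1, integral_Ioc_eq_integral_Ioo] at hftc
    rw [hD, psiInt_psiInt_one_sub hφ hpos hφ'c hα0 hα1 hz.1 hgcont, hcongr, hftc, hv0]
    ring
  have hle_W : ∀ {f : ℝ → ℝ}, ContinuousOn f (Icc 0 b) → ∀ z ∈ Icc 0 b,
      |f z| ≤ sSup ((fun z => |f z|) '' Icc 0 b) := fun hf z hz =>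
    le_csSup (isCompact_Icc.bddAbove_image hf.abs) (mem_image_of_mem _ hz)
  have hn : ∀ z ∈ Icc 0 b, n z ≤ W₁ := fun z hz =>
    hW₁ ▸ (le_abs_self _).trans (hle_W hn_cont z hz)
  have hk : ∀ z ∈ Icc 0 b, k z ≤ W₂ := fun z hz =>
    hW₂ ▸ (le_abs_self _).trans (hle_W hk_cont z hz)
  have hW₁0 : 0 ≤ W₁ := hW₁ ▸ (abs_nonneg _).trans (hle_W hn_cont 0 h0b)
  have hW₂0 : 0 ≤ W₂ := hW₂ ▸ (abs_nonneg _).trans (hle_W hk_cont 0 h0b)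
  -- Measurable versions of the two integrands, with a uniform bound.
  set π : ℝ → ℝ := fun τ => projIcc 0 b hb.le τ with hπ
  have hπc : Continuous π := continuous_subtype_val.comp continuous_projIcc
  have hπmem : ∀ τ, π τ ∈ Icc 0 b := fun τ => (projIcc 0 b hb.le τ).2
  have hπeq : ∀ τ ∈ Icc 0 b, π τ = τ := fun τ hτ => by simp only [hπ, projIcc_of_mem _ hτ]
  have hHm : ∀ z ∈ Icc 0 b, ∀ w : ℝ → ℝ, Measurable w → Measurable fun τ => H z (π τ) (w τ) := by
    intro z hz w hw
    have hc : Continuous fun q : ℝ × ℝ => H z (π q.1) q.2 :=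
      hH_cont.comp_continuous (f := fun q : ℝ × ℝ => (z, π q.1, q.2)) (by fun_prop)
        fun q => ⟨hz, hπmem _, mem_univ _⟩
    exact hc.measurable.comp (measurable_id.prodMk hw)
  obtain ⟨CH, hCH⟩ : ∃ C, ∀ z ∈ Icc 0 b, ∀ τ, |H z (π τ) 0| ≤ C := by
    obtain ⟨C, hC⟩ := ((isCompact_Icc (a := 0) (b := b)).prod
      ((isCompact_Icc (a := 0) (b := b)).prod
        (isCompact_singleton (x := (0:ℝ))))).exists_bound_of_continuousOn
      (hH_cont.mono (prod_mono_right (prod_mono_right (subset_univ _))))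
    exact ⟨C, fun z hz τ => hC (z, π τ, 0) ⟨hz, hπmem τ, rfl⟩⟩
  have hCH0 : 0 ≤ CH := (abs_nonneg _).trans (hCH 0 h0b 0)
  have hHlip : ∀ z ∈ Icc 0 b, ∀ τ, |H z (π τ) (D τ) - H z (π τ) 0| ≤ W₂ * |D τ| :=
    fun z hz τ => by
      have h := hQ2 z hz (π τ) (hπmem τ) (D τ) 0
      rw [sub_zero] at h
      exact h.trans (mul_le_mul_of_nonneg_right (hk z hz) (abs_nonneg _))
  have hI0 : ∀ z ∈ Icc 0 b, psiInt α ψ ψ' (fun τ => H z τ 0) z =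
      psiInt α φ φ' (fun τ => H z (π τ) 0) z := fun z hz =>
    htransfer hz fun τ hτ => by simp only [hπeq τ hτ]
  have hID : ∀ z ∈ Icc 0 b, psiInt α ψ ψ' (fun τ => H z τ (psiCaputo α ψ ψ' v' τ)) z =
      psiInt α φ φ' (fun τ => H z (π τ) (D τ)) z := fun z hz =>
    htransfer hz fun τ hτ => by simp only [hπeq τ hτ, hDeq hτ]
  have hF0 : ∀ z ∈ Icc 0 b, |F z 0 (psiInt α φ φ' (fun τ => H z (π τ) 0) z)| ≤ W₃ := by
    intro z hz
    rw [hW₃, ← hI0 z hz]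
    refine le_csSup ?_ (mem_image_of_mem
      (fun z => |F z 0 (psiInt α ψ ψ' (fun τ => H z τ 0) z)|) hz)
    set R := CH * ((φ b - φ 0) ^ α / Real.Gamma (α + 1))
    obtain ⟨C, hC⟩ := ((isCompact_Icc (a := 0) (b := b)).prod
      ((isCompact_singleton (x := (0:ℝ))).prod
        (isCompact_Icc (a := -R) (b := R)))).exists_bound_of_continuousOn
      (hF_cont.mono (prod_mono_right (prod_mono (subset_univ _) (subset_univ _))))
    refine ⟨C, ?_⟩
    rintro _ ⟨y, hy, rfl⟩
    simp only [hI0 y hy]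
    exact hC (y, 0, _) ⟨hy, rfl, abs_le.1 (abs_psiInt_le_of_le hφ hpos hα0 hy.1 hy.2 hCH0
      (hHm y hy _ measurable_const) fun s _ => hCH y hy s)⟩
  have hW₃0 : 0 ≤ W₃ := (abs_nonneg _).trans (hF0 0 h0b)
  have hDabs : ∀ z ∈ Icc 0 b, ∀ s ∈ Ioo 0 z, |(|D s|)| ≤ CD := fun z hz s hs => by
    rw [abs_abs]; exact hCD s (hsub' z hz s hs)
  set e : ℝ → ℝ := fun z => |v₀| + psiInt α φ φ' (fun s => |D s|) z with he
  have hem : Measurable e := measurable_const.add (measurable_psiInt hφm hφ'm hDm.abs)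
  set L := W₁ * (1 + W₂) with hL
  have hL0 : 0 ≤ L := by positivity
  set Q := (φ b - φ 0) ^ α / Real.Gamma (α + 1) with hQ
  have hQ0 : 0 ≤ Q := div_nonneg (Real.rpow_nonneg (sub_nonneg.2 (hmono.monotone hb.le)) _)
    (Real.Gamma_pos_of_pos (by linarith)).le
  have hve : ∀ z ∈ Icc 0 b, |v z| ≤ e z := fun z hz => by
    rw [hvD z hz]
    exact (abs_add_le _ _).trans (add_le_add_right (abs_psiInt_le hφ hpos hα0 hz.1 hDm hDm.abs
      (hDabs z hz) fun _ _ => le_rfl) _)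
  have heM : ∀ z ∈ Icc 0 b, |e z| ≤ |v₀| + CD * Q := fun z hz => by
    refine (abs_add_le _ _).trans ?_
    rw [abs_abs]
    exact add_le_add_right (abs_psiInt_le_of_le hφ hpos hα0 hz.1 hz.2 hCD0 hDm.abs
      (hDabs z hz)) _
  have hDe : ∀ z ∈ Icc 0 b, |D z| ≤ W₃ + L * e z := by
    intro z hz
    set ID := psiInt α φ φ' (fun τ => H z (π τ) (D τ)) z with hIDdef
    set I0 := psiInt α φ φ' (fun τ => H z (π τ) 0) z with hI0def
    set J := psiInt α φ φ' (fun s => |D s|) z with hJ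
    have hdiff : |ID - I0| ≤ W₂ * J := by
      have hb0 : ∀ s ∈ Ioo 0 z, |H z (π s) 0| ≤ CH := fun s _ => hCH z hz s
      have hbd : ∀ s ∈ Ioo 0 z, |W₂ * (|D s|)| ≤ W₂ * CD := fun s hs => by
        rw [abs_mul, abs_of_nonneg hW₂0]
        exact mul_le_mul_of_nonneg_left (hDabs z hz s hs) hW₂0
      have hm0 := hHm z hz _ (measurable_const (a := (0:ℝ)))
      have hmd : Measurable fun τ => H z (π τ) (D τ) - H z (π τ) 0 := (hHm z hz _ hDm).sub hm0
      have hadd := psiInt_add hφ hpos hα0 hz.1 hmd hm0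
        (fun s hs => (hHlip z hz s).trans ((le_abs_self _).trans (hbd s hs))) hb0
      simp only [sub_add_cancel] at hadd
      rw [hIDdef, hI0def, hadd, add_sub_cancel_right, hJ, ← psiInt_const_mul]
      exact abs_psiInt_le hφ hpos hα0 hz.1 hmd (hDm.abs.const_mul _) hbd
        fun s _ => hHlip z hz s
    have hsz := hsol z hz
    rw [hDeq hz, hID z hz] at hsz
    have hlip := hQ1 z hz (v z) ID 0 I0
    rw [sub_zero, ← hsz] at hlip
    have hJ0 : 0 ≤ J := by
      have h := abs_psiInt_le hφ hpos hα0 hz.1 hDm hDm.abs (hDabs z hz) fun _ _ => le_rfl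
      exact (abs_nonneg _).trans h
    have hJe : J ≤ e z := le_add_of_nonneg_left (abs_nonneg _)
    calc |D z| = |(D z - F z 0 I0) + F z 0 I0| := by rw [sub_add_cancel]
      _ ≤ n z * (|v z| + |ID - I0|) + W₃ :=
          (abs_add_le _ _).trans (add_le_add hlip (hF0 z hz))
      _ ≤ W₁ * (e z + W₂ * e z) + W₃ := by
          gcongr
          · exact hn z hz
          · exact hve z hz
          · exact hdiff.trans (by gcongr)
      _ = _ := by rw [hL]; ring
  have hgron : ∀ z ∈ Icc 0 b, e z ≤ (|v₀| + Q * W₃) + L * psiInt α φ φ' e z := by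
    intro z hz
    have hbe : ∀ s ∈ Ioo 0 z, |L * e s| ≤ L * (|v₀| + CD * Q) := fun s hs => by
      rw [abs_mul, abs_of_nonneg hL0]
      exact mul_le_mul_of_nonneg_left (heM s (hsub' z hz s hs)) hL0
    have hbW : ∀ s ∈ Ioo 0 z, |W₃| ≤ W₃ := fun _ _ => (abs_of_nonneg hW₃0).le
    have h1 : psiInt α φ φ' (fun s => |D s|) z ≤ psiInt α φ φ' (fun s => W₃ + L * e s) z :=
      psiInt_mono hφ hpos hα0 hz.1 hDm.abs (measurable_const.add (hem.const_mul L))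
      (hDabs z hz) (fun s hs => (abs_add_le _ _).trans (add_le_add (hbW s hs) (hbe s hs)))
      fun s hs => hDe s (hsub' z hz s hs)
    have h2 := psiInt_add hφ hpos hα0 hz.1 measurable_const (hem.const_mul L) hbW hbe
    have h3 := (le_abs_self _).trans (abs_psiInt_le_of_le hφ hpos hα0 hz.1 hz.2 hW₃0
      measurable_const hbW)
    rw [psiInt_const_mul] at h2
    have h4 : e z = |v₀| + psiInt α φ φ' (fun s => |D s|) z := rfl
    linarith
  intro z hz
  have hfin := le_mul_mittagLeffler_of_le_add_psiInt hφ hpos hα0 hL0 hem heM hgron hz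
  have hφz : 0 ≤ φ z - φ 0 := sub_nonneg.2 (hmono.monotone hz.1)
  have hφzb : φ z ≤ φ b := hmono.monotone hz.2
  have hML : mittagLeffler α (L * (φ z - φ 0) ^ α) ≤ mittagLeffler α (L * (φ b - φ 0) ^ α) :=
    mittagLeffler_mono hα0 (by positivity) (by gcongr)
  have hML0 := mittagLeffler_nonneg hα0 (x := L * (φ z - φ 0) ^ α) (by positivity)
  rw [hψφ hbb, hψφ h0b, ← hQ]
  calc |v z| ≤ e z := hve z hz
    _ ≤ _ := hfin
    _ ≤ _ := by
        refine mul_le_mul ?_ hML hML0 (by positivity)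
        have : 0 ≤ Q * (W₂ * |v₀|) := by positivity
        linarith
end

section
/- (Generalized Ulam–Hyers stability.) Let 0 < α < 1, b > 0, J = [0,b]. Let ψ : J → ℝ be increasing and continuously differentiable with ψ'(z) > 0 for all z ∈ J. Let F : J × ℝ × ℝ → ℝ and H : J × J × ℝ → ℝ be continuous satisfying (Q1) |F(z, u₁, u₂) − F(z, v₁, v₂)| ≤ n(z)(|u₁ − v₁| + |u₂ − v₂|) and (Q2) |H(z, τ, u) − H(z, τ, v)| ≤ k(z)|u − v| for continuous n, k : J → ℝ, and set W₁ = sup_{z ∈ J} |n(z)|, W₂ = sup_{z ∈ J} |k(z)|. Then there exists a continuous function ρ : [0,∞) → [0,∞) with ρ(0) = 0 such that: for every ε > 0, every continuously differentiable ω : J → ℝ with |N^{α,ψ}ω(z) − F(z, ω(z), (1/Γ(α)) ∫₀^z ψ'(τ)(ψ(z) − ψ(τ))^{α−1} H(z, τ, N^{α,ψ}ω(τ)) dτ)| ≤ ε for all z ∈ J, and every continuously differentiable solution ϑ : J → ℝ of N^{α,ψ}ϑ(z) = F(z, ϑ(z), (1/Γ(α)) ∫₀^z ψ'(τ)(ψ(z)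 − ψ(τ))^{α−1} H(z, τ, N^{α,ψ}ϑ(τ)) dτ) on J with ϑ(0) = ω(0), one has |ω(z) − ϑ(z)| ≤ ρ(ε) for all z ∈ J. -/
open MeasureTheory Set

/-- The unnormalised Riemann–Liouville fractional integral `∫₀ˢ (s - t)^(β-1) g(t) dt`. -/
noncomputable def abelIntegral (β : ℝ) (g : ℝ → ℝ) (s : ℝ) : ℝ :=
  ∫ t in (0:ℝ)..s, (s - t) ^ (β - 1) * g t

theorem intervalIntegrable_sub_rpow {β : ℝ} (hβ : 0 < β) (s : ℝ) :
    IntervalIntegrable (fun t => (s - t) ^ (β - 1)) volume 0 s := by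
  have h : IntervalIntegrable (fun t : ℝ => t ^ (β - 1)) volume 0 s :=
    intervalIntegral.intervalIntegrable_rpow' (by linarith)
  simpa using (h.comp_sub_left s).symm

theorem intervalIntegrable_abel {β : ℝ} (hβ : 0 < β) {s : ℝ} (hs : 0 ≤ s) {g : ℝ → ℝ}
    (hg : ContinuousOn g (Icc 0 s)) :
    IntervalIntegrable (fun t => (s - t) ^ (β - 1) * g t) volume 0 s :=
  (intervalIntegrable_sub_rpow hβ s).mul_continuousOn (by rwa [uIcc_of_le hs])

theorem abelIntegral_sub {β s : ℝ} (hβ : 0 < β) (hs : 0 ≤ s) {f g : ℝ → ℝ}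
    (hf : ContinuousOn f (Icc 0 s)) (hg : ContinuousOn g (Icc 0 s)) :
    abelIntegral β (fun t => f t - g t) s = abelIntegral β f s - abelIntegral β g s := by
  unfold abelIntegral
  rw [← intervalIntegral.integral_sub (intervalIntegrable_abel hβ hs hf)
    (intervalIntegrable_abel hβ hs hg)]
  simp only [mul_sub]

theorem abelIntegral_const_mul (β c : ℝ) (g : ℝ → ℝ) (s : ℝ) :
    abelIntegral β (fun t => c * g t) s = c * abelIntegral β g s := by
  unfold abelIntegral
  rw [← intervalIntegral.integral_const_mul]
  congr 1 with t
  ring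

theorem abs_abelIntegral_le {β s : ℝ} (hβ : 0 < β) (hs : 0 ≤ s) {f g : ℝ → ℝ}
    (hg : ContinuousOn g (Icc 0 s)) (h : ∀ t ∈ Icc 0 s, |f t| ≤ g t) :
    |abelIntegral β f s| ≤ abelIntegral β g s := by
  unfold abelIntegral
  rw [← Real.norm_eq_abs]
  refine intervalIntegral.norm_integral_le_of_norm_le hs (ae_of_all _ fun t ht => ?_)
    (intervalIntegrable_abel hβ hs hg)
  have h0 : 0 ≤ (s - t) ^ (β - 1) := Real.rpow_nonneg (by linarith [ht.2]) _
  rw [norm_mul, Real.norm_of_nonneg h0]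
  exact mul_le_mul_of_nonneg_left (h t (Ioc_subset_Icc_self ht)) h0

theorem abelIntegral_eq_rpow_mul {β : ℝ} (hβ : 0 < β) (g : ℝ → ℝ) {s : ℝ} (hs : 0 ≤ s) :
    abelIntegral β g s = s ^ β * ∫ x in (0:ℝ)..1, (1 - x) ^ (β - 1) * g (s * x) := by
  rcases hs.eq_or_lt with rfl | hs
  · simp [abelIntegral, Real.zero_rpow hβ.ne']
  have h1 := intervalIntegral.smul_integral_comp_mul_left (a := 0) (b := 1)
    (fun t => (s - t) ^ (β - 1) * g t) s
  rw [mul_zero, mul_one] at h1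
  rw [abelIntegral, ← h1, smul_eq_mul, ← intervalIntegral.integral_const_mul,
    ← intervalIntegral.integral_const_mul]
  refine intervalIntegral.integral_congr fun x hx => ?_
  rw [uIcc_of_le zero_le_one] at hx
  have h2 : s - s * x = s * (1 - x) := by ring
  simp only [h2]
  rw [Real.mul_rpow hs.le (by linarith [hx.2]), Real.rpow_sub_one hs.ne']
  field_simp

theorem continuousOn_abelIntegral {β : ℝ} (hβ : 0 < β) {g : ℝ → ℝ} (hg : Continuous g) :
    ContinuousOn (abelIntegral β g) (Ici 0) := by
  have hc : Continuous fun s : ℝ => ∫ x in (0:ℝ)..1, (1 - x) ^ (β - 1) * g (s * x) := by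
    refine continuous_iff_continuousAt.2 fun s₀ => ?_
    obtain ⟨M, hM⟩ := (isCompact_Icc (a := -(|s₀| + 1)) (b := |s₀| + 1)).exists_bound_of_continuousOn
      hg.continuousOn
    refine intervalIntegral.continuousAt_of_dominated_interval
      (bound := fun x => (1 - x) ^ (β - 1) * M) ?_ ?_ ?_ ?_
    · refine Filter.Eventually.of_forall fun s => ?_
      exact ((intervalIntegrable_sub_rpow hβ 1).mul_continuousOn
        (g := fun x => g (s * x)) (by fun_prop)).def'.aestronglyMeasurable
    · filter_upwards [Metric.ball_mem_nhds s₀ one_pos] with s hs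
      refine ae_of_all _ fun x hx => ?_
      rw [uIoc_of_le zero_le_one] at hx
      have h0 : 0 ≤ (1 - x) ^ (β - 1) := Real.rpow_nonneg (by linarith [hx.2]) _
      rw [norm_mul, Real.norm_of_nonneg h0]
      refine mul_le_mul_of_nonneg_left (hM _ ?_) h0
      rw [mem_Icc, ← abs_le, abs_mul, abs_of_pos hx.1]
      rw [Metric.mem_ball, Real.dist_eq] at hs
      have h1 : |s| ≤ |s₀| + 1 := by
        have := abs_sub_abs_le_abs_sub s s₀
        linarith
      nlinarith [abs_nonneg s, hx.1, hx.2]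
    · exact (intervalIntegrable_sub_rpow hβ 1).mul_const M
    · refine ae_of_all _ fun x _ => ?_
      fun_prop
  refine ContinuousOn.congr ((Real.continuous_rpow_const hβ.le).mul hc).continuousOn
    fun s hs => abelIntegral_eq_rpow_mul hβ g hs

theorem integral_rpow_neg_mul_sub_rpow {α w : ℝ} (hα0 : 0 < α) (hα1 : α < 1) (hw : 0 < w) :
    ∫ x in (0:ℝ)..w, x ^ (-α) * (w - x) ^ (α - 1) = Real.Gamma (1 - α) * Real.Gamma α := by
  have h1 := Complex.betaIntegral_scaled ((1 - α : ℝ) : ℂ) (α : ℂ) hw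
  have h2 := Complex.Gamma_mul_Gamma_eq_betaIntegral (s := ((1 - α : ℝ) : ℂ)) (t := (α : ℂ))
    (by rw [Complex.ofReal_re]; linarith) (by simpa using hα0)
  have h3 : ((1 - α : ℝ) : ℂ) + (α : ℂ) = 1 := by push_cast; ring
  rw [h3, Complex.Gamma_one, one_mul] at h2
  rw [h3, sub_self, Complex.cpow_zero, one_mul, ← h2] at h1
  have h4 : (∫ x in (0:ℝ)..w, (x : ℂ) ^ (((1 - α : ℝ) : ℂ) - 1) * ((w : ℂ) - x) ^ ((α : ℂ) - 1))
      = ∫ x in (0:ℝ)..w, ((x ^ (-α) * (w - x) ^ (α - 1) : ℝ) : ℂ) := by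
    refine intervalIntegral.integral_congr fun x hx => ?_
    rw [uIcc_of_le hw.le] at hx
    rw [Complex.ofReal_mul, Complex.ofReal_cpow hx.1, Complex.ofReal_cpow (by linarith [hx.2])]
    push_cast
    ring_nf
  rw [h4, intervalIntegral.integral_ofReal, Complex.Gamma_ofReal, Complex.Gamma_ofReal] at h1
  exact_mod_cast h1

/-- The semigroup property of fractional integration for the complementary orders `α`, `1 - α`. -/
theorem abelIntegral_abelIntegral {α : ℝ} (hα0 : 0 < α) (hα1 : α < 1) {f : ℝ → ℝ}
    (hf : Continuous f) {s : ℝ} (hs : 0 ≤ s) :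
    abelIntegral α (abelIntegral (1 - α) f) s =
      Real.Gamma (1 - α) * Real.Gamma α * ∫ t in (0:ℝ)..s, f t := by
  let k : ℝ → ℝ := (Ioc 0 s).indicator f
  let q : ℝ → ℝ := (Ioc 0 s).indicator fun t => t ^ (-α)
  let p : ℝ → ℝ := (Ioc 0 s).indicator fun t => t ^ (α - 1)
  let m := ContinuousLinearMap.mul ℝ ℝ
  have hk : Integrable k :=
    (hf.integrableOn_Ioc).integrable_indicator measurableSet_Ioc
  have hq : Integrable q := by
    refine IntegrableOn.integrable_indicator ?_ measurableSet_Ioc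
    exact (intervalIntegrable_iff_integrableOn_Ioc_of_le hs).1
      (intervalIntegral.intervalIntegrable_rpow' (by linarith))
  have hp : Integrable p := by
    refine IntegrableOn.integrable_indicator ?_ measurableSet_Ioc
    exact (intervalIntegrable_iff_integrableOn_Ioc_of_le hs).1
      (intervalIntegral.intervalIntegrable_rpow' (by linarith))
  obtain ⟨M, hM⟩ := (isCompact_Icc (a := 0) (b := s)).exists_bound_of_continuousOn hf.continuousOn
  have hkM : ∀ t, ‖k t‖ ≤ |M| := fun t => by
    by_cases ht : t ∈ Ioc 0 s
    · simp only [k, indicator_of_mem ht]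
      exact (hM t (Ioc_subset_Icc_self ht)).trans (le_abs_self _)
    · simp [k, indicator_of_notMem ht]
  have hassoc := convolution_assoc (x₀ := s) (f := k) (g := q) (k := p) (μ := volume)
    (ν := volume) m m m m (fun x y z => mul_assoc x y z)
    hk.aestronglyMeasurable hq.aestronglyMeasurable hp.aestronglyMeasurable
    (hk.ae_convolution_exists m hq) (hq.norm.ae_convolution_exists m hp.norm) (by
      have h1 := (hq.norm.integrable_convolution m hp.norm).comp_sub_left s
      refine h1.bdd_mul (c := |M|) hk.norm.aestronglyMeasurable (ae_of_all _ fun t => ?_)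
      simpa using hkM t)
  have hqp : ∀ w ∈ Ioc 0 s, (convolution q p m volume) w =
      Real.Gamma (1 - α) * Real.Gamma α := fun w hw => by
    rw [← integral_rpow_neg_mul_sub_rpow hα0 hα1 hw.1, intervalIntegral.integral_of_le hw.1.le,
      integral_Ioc_eq_integral_Ioo, ← integral_indicator measurableSet_Ioo]
    refine integral_congr_ae (ae_of_all _ fun t => ?_)
    simp only [m, ContinuousLinearMap.mul_apply', q, p, indicator_apply, mem_Ioc, mem_Ioo]
    obtain ⟨-, hw2⟩ := hw
    split_ifs <;> first | rfl | grind
  have hkq : ∀ t ∈ Icc 0 s, (convolution k q m volume) t = abelIntegral (1 - α) f t :=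
      fun t ht => by
    rw [abelIntegral, intervalIntegral.integral_of_le ht.1,
      integral_Ioc_eq_integral_Ioo, ← integral_indicator measurableSet_Ioo]
    refine integral_congr_ae (ae_of_all _ fun u => ?_)
    simp only [m, ContinuousLinearMap.mul_apply', q, k, indicator_apply, mem_Ioc, mem_Ioo]
    obtain ⟨-, ht2⟩ := ht
    have h3 : 1 - α - 1 = -α := by ring
    rw [h3]
    split_ifs <;> first | exact mul_comm _ _ | grind
  have hl : (convolution (convolution k q m volume) p m volume) s =
      abelIntegral α (abelIntegral (1 - α) f) s := by
    rw [abelIntegral, intervalIntegral.integral_of_le hs, integral_Ioc_eq_integral_Ioo,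
      ← integral_Ico_eq_integral_Ioo, ← integral_indicator measurableSet_Ico]
    refine integral_congr_ae (ae_of_all _ fun t => ?_)
    by_cases ht : t ∈ Ico 0 s
    · have h4 : s - t ∈ Ioc 0 s := ⟨by linarith [ht.2], by linarith [ht.1]⟩
      simp only [m, ContinuousLinearMap.mul_apply', indicator_of_mem ht, p, indicator_of_mem h4]
      rw [mul_comm, ← hkq t (Ico_subset_Icc_self ht)]
    · have h4 : s - t ∉ Ioc 0 s := fun h => ht ⟨by linarith [h.2], by linarith [h.1]⟩
      simp only [m, ContinuousLinearMap.mul_apply', indicator_of_notMem ht, p,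
        indicator_of_notMem h4, mul_zero]
  rw [← hl, hassoc, ← intervalIntegral.integral_const_mul, intervalIntegral.integral_of_le hs,
    integral_Ioc_eq_integral_Ioo, ← integral_indicator measurableSet_Ioo]
  refine integral_congr_ae ?_
  filter_upwards [compl_mem_ae_iff.2 (measure_singleton (μ := volume) s)] with t hts
  by_cases ht : t ∈ Ioo 0 s
  · have h4 : s - t ∈ Ioc 0 s := ⟨by linarith [ht.2], by linarith [ht.1]⟩
    have h5 := hqp _ h4
    simp only [m, ContinuousLinearMap.mul_apply', indicator_of_mem ht, k,
      indicator_of_mem (Ioo_subset_Ioc_self ht)]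
    rw [mul_comm, ← h5]
  · have h4 : t ∉ Ioc 0 s := fun h => ht ⟨h.1, lt_of_le_of_ne h.2 hts⟩
    simp only [m, ContinuousLinearMap.mul_apply', indicator_of_notMem ht, k,
      indicator_of_notMem h4, zero_mul]

theorem abelIntegral_exp_le {β lam s : ℝ} (hβ : 0 < β) (hlam : 0 < lam) (hs : 0 ≤ s) :
    abelIntegral β (fun t => Real.exp (lam * t)) s ≤
      Real.exp (lam * s) * ((1 / lam) ^ β * Real.Gamma β) := by
  rw [← Real.integral_rpow_mul_exp_neg_mul_Ioi hβ hlam]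
  have h1 := intervalIntegral.integral_comp_sub_left (a := 0) (b := s)
    (fun u => u ^ (β - 1) * Real.exp (lam * (s - u))) s
  simp only [sub_sub_cancel, sub_zero, sub_self] at h1
  rw [abelIntegral, h1, intervalIntegral.integral_of_le hs, ← integral_const_mul]
  have hint : IntegrableOn (fun t : ℝ => t ^ (β - 1) * Real.exp (-(lam * t))) (Ioi 0) := by
    by_contra h
    have h2 := Real.integral_rpow_mul_exp_neg_mul_Ioi hβ hlam
    rw [integral_undef h] at h2
    have : 0 < (1 / lam) ^ β * Real.Gamma β := mul_pos (by positivity) (Real.Gamma_pos_of_pos hβ)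
    linarith
  have h3 : ∀ u : ℝ, u ^ (β - 1) * Real.exp (lam * (s - u)) =
      Real.exp (lam * s) * (u ^ (β - 1) * Real.exp (-(lam * u))) := fun u => by
    have h4 : lam * (s - u) = lam * s + -(lam * u) := by ring
    rw [h4, Real.exp_add]
    ring
  simp only [h3]
  refine setIntegral_mono_set (hint.const_mul _) ?_ Ioc_subset_Ioi_self.eventuallyLE
  filter_upwards [ae_restrict_mem measurableSet_Ioi] with u hu
  have := Real.rpow_nonneg (le_of_lt hu) (β - 1)
  simp only [Pi.zero_apply]
  positivity

/-- A Gronwall inequality for weakly singular kernels. -/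
theorem exists_bound_of_le_add_abelIntegral {β C T : ℝ} (hβ : 0 < β) (hC : 0 ≤ C) (hT : 0 ≤ T) :
    ∃ K : ℝ, 0 ≤ K ∧ ∀ (ε : ℝ) (G : ℝ → ℝ), 0 ≤ ε → ContinuousOn G (Icc 0 T) →
      (∀ s ∈ Icc 0 T, G s ≤ ε + C * abelIntegral β G s) → ∀ s ∈ Icc 0 T, G s ≤ K * ε := by
  have hΓ := Real.Gamma_pos_of_pos hβ
  obtain ⟨lam, hlam, hsmall⟩ : ∃ lam : ℝ, 0 < lam ∧ C * ((1 / lam) ^ β * Real.Gamma β) ≤ 1 / 2 := by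
    have hA : 0 < 2 * (C * Real.Gamma β + 1) := by positivity
    refine ⟨(2 * (C * Real.Gamma β + 1)) ^ (1 / β), by positivity, ?_⟩
    rw [Real.div_rpow zero_le_one (by positivity), ← Real.rpow_mul hA.le,
      one_div_mul_cancel hβ.ne', Real.rpow_one, Real.one_rpow]
    have h1 : C * (1 / (2 * (C * Real.Gamma β + 1)) * Real.Gamma β) =
      (C * Real.Gamma β) / (2 * (C * Real.Gamma β + 1)) := by ring
    rw [h1, div_le_div_iff₀ hA two_pos]
    linarith
  refine ⟨2 * Real.exp (lam * T), by positivity, fun ε G hε hG hle => ?_⟩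
  obtain ⟨s₀, hs₀, hmax⟩ := (isCompact_Icc (a := 0) (b := T)).exists_isMaxOn
    (nonempty_Icc.2 hT) (f := fun s => G s * Real.exp (-(lam * s))) (by fun_prop)
  set M := G s₀ * Real.exp (-(lam * s₀)) with hM
  have hGM : ∀ s ∈ Icc 0 T, G s ≤ M * Real.exp (lam * s) := fun s hs => by
    have h1 : G s * Real.exp (-(lam * s)) ≤ M := hmax hs
    have h2 := mul_le_mul_of_nonneg_right h1 (Real.exp_pos (lam * s)).le
    rwa [mul_assoc, ← Real.exp_add, neg_add_cancel, Real.exp_zero, mul_one] at h2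
  have hG₀ : G s₀ = M * Real.exp (lam * s₀) := by
    rw [hM, mul_assoc, ← Real.exp_add, neg_add_cancel, Real.exp_zero, mul_one]
  have hM2 : M ≤ 2 * ε := by
    rcases le_or_gt M 0 with hM0 | hM0
    · linarith
    have hsub : Icc 0 s₀ ⊆ Icc 0 T := Icc_subset_Icc_right hs₀.2
    have h1 : abelIntegral β G s₀ ≤ M * abelIntegral β (fun t => Real.exp (lam * t)) s₀ := by
      rw [← abelIntegral_const_mul]
      refine intervalIntegral.integral_mono_on hs₀.1
        (intervalIntegrable_abel hβ hs₀.1 (hG.mono hsub))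
        (intervalIntegrable_abel hβ hs₀.1 (by fun_prop)) fun t ht => ?_
      exact mul_le_mul_of_nonneg_left (hGM t (hsub ht))
        (Real.rpow_nonneg (by linarith [ht.2]) _)
    have h2 := abelIntegral_exp_le hβ hlam hs₀.1
    have h3 := hle s₀ hs₀
    have h4 : C * abelIntegral β G s₀ ≤ M * Real.exp (lam * s₀) * (1 / 2) := by
      calc C * abelIntegral β G s₀
          ≤ C * (M * (Real.exp (lam * s₀) * ((1 / lam) ^ β * Real.Gamma β))) := by
            gcongr
            exact h1.trans (by gcongr)
        _ = M * Real.exp (lam * s₀) * (C * ((1 / lam) ^ β * Real.Gamma β)) := by ring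
        _ ≤ _ := by gcongr
    have h5 : 1 ≤ Real.exp (lam * s₀) := Real.one_le_exp (mul_nonneg hlam.le hs₀.1)
    have h6 : M * 1 ≤ M * Real.exp (lam * s₀) := by gcongr
    linarith
  intro s hs
  calc G s ≤ M * Real.exp (lam * s) := hGM s hs
    _ ≤ (2 * ε) * Real.exp (lam * T) := by
      gcongr
      exact hs.2
    _ = _ := by ring

/-- A function continuous on `[0, b]` factors through the change of variables `ψ - ψ 0`. -/
theorem exists_continuous_comp_sub_eq {b : ℝ} {ψ h : ℝ → ℝ} (hψ_inj : InjOn ψ (Icc 0 b))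
    (hψ_cont : ContinuousOn ψ (Icc 0 b)) (hh : ContinuousOn h (Icc 0 b)) :
    ∃ g : ℝ → ℝ, Continuous g ∧ ∀ z ∈ Icc 0 b, g (ψ z - ψ 0) = h z := by
  let e : Icc 0 b → ℝ := fun z => ψ z - ψ 0
  have he : Topology.IsClosedEmbedding e := by
    refine Continuous.isClosedEmbedding ?_ fun x y hxy => ?_
    · exact hψ_cont.domRestrict.sub continuous_const
    · exact Subtype.ext (hψ_inj x.2 y.2 (sub_left_injective hxy))
  obtain ⟨g, hg⟩ := ContinuousMap.exists_extension' he ⟨_, hh.domRestrict⟩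
  exact ⟨g, g.continuous, fun z hz => congrFun hg ⟨z, hz⟩⟩

theorem integral_deriv_mul_comp_sub {b : ℝ} {ψ ψ' : ℝ → ℝ} (hψ_mono : StrictMonoOn ψ (Icc 0 b))
    (hψ_deriv : ∀ z ∈ Icc 0 b, HasDerivWithinAt ψ (ψ' z) (Icc 0 b) z) (Φ : ℝ → ℝ)
    {z : ℝ} (hz : z ∈ Icc 0 b) :
    ∫ κ in (0:ℝ)..z, ψ' κ * Φ (ψ κ - ψ 0) = ∫ t in (0:ℝ)..(ψ z - ψ 0), Φ t := by
  have hsub : Icc 0 z ⊆ Icc 0 b := Icc_subset_Icc_right hz.2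
  have hmono := hψ_mono.monotoneOn.mono hsub
  have hle : ψ 0 ≤ ψ z := hmono (left_mem_Icc.2 hz.1) (right_mem_Icc.2 hz.1) hz.1
  have himg : (fun κ => ψ κ - ψ 0) '' Icc 0 z = Icc 0 (ψ z - ψ 0) := by
    have hc : ContinuousOn (fun κ => ψ κ - ψ 0) (Icc 0 z) := fun κ hκ =>
      (((hψ_deriv κ (hsub hκ)).continuousWithinAt).mono hsub).sub continuousWithinAt_const
    refine Subset.antisymm ?_ ?_
    · rintro _ ⟨κ, hκ, rfl⟩
      exact ⟨sub_nonneg.2 (hmono (left_mem_Icc.2 hz.1) hκ hκ.1),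
        sub_le_sub_right (hmono hκ (right_mem_Icc.2 hz.1) hκ.2) _⟩
    · simpa using intermediate_value_Icc hz.1 hc
  have h := integral_image_eq_integral_deriv_smul_of_monotoneOn (s := Icc 0 z)
    (f := fun κ => ψ κ - ψ 0) (f' := ψ') measurableSet_Icc
    (fun κ hκ => ((hψ_deriv κ (hsub hκ)).mono hsub).sub_const _)
    (fun x hx y hy hxy => sub_le_sub_right (hmono hx hy hxy) _) Φ
  rw [himg] at h
  rw [intervalIntegral.integral_of_le hz.1, intervalIntegral.integral_of_le (sub_nonneg.2 hle),
    ← integral_Icc_eq_integral_Ioc, ← integral_Icc_eq_integral_Ioc, h]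
  rfl

theorem integral_kernel_eq_abelIntegral {b β : ℝ} {ψ ψ' g h : ℝ → ℝ}
    (hψ_mono : StrictMonoOn ψ (Icc 0 b))
    (hψ_deriv : ∀ z ∈ Icc 0 b, HasDerivWithinAt ψ (ψ' z) (Icc 0 b) z)
    (hgh : ∀ z ∈ Icc 0 b, g (ψ z - ψ 0) = h z) {z : ℝ} (hz : z ∈ Icc 0 b) :
    ∫ κ in (0:ℝ)..z, ψ' κ * (ψ z - ψ κ) ^ (β - 1) * h κ = abelIntegral β g (ψ z - ψ 0) := by
  rw [abelIntegral, ← integral_deriv_mul_comp_sub hψ_mono hψ_deriv _ hz]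
  refine intervalIntegral.integral_congr fun κ hκ => ?_
  rw [uIcc_of_le hz.1] at hκ
  rw [hgh κ ⟨hκ.1, hκ.2.trans hz.2⟩, sub_sub_sub_cancel_right, mul_assoc]

/-- Generalized Ulam–Hyers stability: there is a continuous `ρ : [0,∞) → [0,∞)` with
`ρ(0) = 0` such that any `ε`-approximate solution `ω` and any exact solution `ϑ` with
the same initial value satisfy `|ω(z) - ϑ(z)| ≤ ρ(ε)` on `[0,b]`. -/
theorem caputo_generalized_ulam_hyers_stability (α b : ℝ) (hα0 : 0 < α) (hα1 : α < 1)
    (hb : 0 < b)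
    (ψ ψ' : ℝ → ℝ)
    (hψ_mono : StrictMonoOn ψ (Set.Icc 0 b))
    (hψ_deriv : ∀ z ∈ Set.Icc 0 b, HasDerivWithinAt ψ (ψ' z) (Set.Icc 0 b) z)
    (hψ'_cont : ContinuousOn ψ' (Set.Icc 0 b))
    (hψ'_pos : ∀ z ∈ Set.Icc 0 b, 0 < ψ' z)
    (F : ℝ → ℝ → ℝ → ℝ) (H : ℝ → ℝ → ℝ → ℝ)
    (hF_cont : ContinuousOn (fun p : ℝ × ℝ × ℝ => F p.1 p.2.1 p.2.2)
      (Set.Icc 0 b ×ˢ (Set.univ : Set ℝ) ×ˢ (Set.univ : Set ℝ)))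
    (hH_cont : ContinuousOn (fun p : ℝ × ℝ × ℝ => H p.1 p.2.1 p.2.2)
      (Set.Icc 0 b ×ˢ Set.Icc 0 b ×ˢ (Set.univ : Set ℝ)))
    (n k : ℝ → ℝ)
    (hn_cont : ContinuousOn n (Set.Icc 0 b))
    (hk_cont : ContinuousOn k (Set.Icc 0 b))
    (hQ1 : ∀ z ∈ Set.Icc 0 b, ∀ u₁ u₂ w₁ w₂ : ℝ,
      |F z u₁ u₂ - F z w₁ w₂| ≤ n z * (|u₁ - w₁| + |u₂ - w₂|))
    (hQ2 : ∀ z ∈ Set.Icc 0 b, ∀ τ ∈ Set.Icc 0 b, ∀ u w : ℝ,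
      |H z τ u - H z τ w| ≤ k z * |u - w|)
    (W₁ W₂ : ℝ)
    (hW₁ : W₁ = sSup ((fun z => |n z|) '' Set.Icc 0 b))
    (hW₂ : W₂ = sSup ((fun z => |k z|) '' Set.Icc 0 b)) :
    ∃ ρ : ℝ → ℝ,
      ContinuousOn ρ (Set.Ici 0) ∧
      (∀ x ∈ Set.Ici (0:ℝ), 0 ≤ ρ x) ∧
      ρ 0 = 0 ∧
      ∀ ε : ℝ, 0 < ε →
        ∀ ω ω' : ℝ → ℝ,
          (∀ z ∈ Set.Icc 0 b, HasDerivWithinAt ω (ω' z) (Set.Icc 0 b) z) →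
          ContinuousOn ω' (Set.Icc 0 b) →
          (∀ z ∈ Set.Icc 0 b,
            |psiCaputo α ψ ψ' ω' z -
              F z (ω z) (psiInt α ψ ψ' (fun τ => H z τ (psiCaputo α ψ ψ' ω' τ)) z)| ≤ ε) →
          ∀ v v' : ℝ → ℝ,
            (∀ z ∈ Set.Icc 0 b, HasDerivWithinAt v (v' z) (Set.Icc 0 b) z) →
            ContinuousOn v' (Set.Icc 0 b) →
            (∀ z ∈ Set.Icc 0 b,
              psiCaputo α ψ ψ' v' z =
                F z (v z) (psiInt α ψ ψ' (fun τ => H z τ (psiCaputo α ψ ψ' v' τ)) z)) →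
            v 0 = ω 0 →
            ∀ z ∈ Set.Icc 0 b, |ω z - v z| ≤ ρ ε := by
  have hψ_cont : ContinuousOn ψ (Icc 0 b) := fun z hz => (hψ_deriv z hz).continuousWithinAt
  have h0b : (0:ℝ) ∈ Icc 0 b := left_mem_Icc.2 hb.le
  have hΓ := Real.Gamma_pos_of_pos hα0
  have hΓ' := Real.Gamma_pos_of_pos (sub_pos.2 hα1)
  have hα1' : 0 < 1 - α := sub_pos.2 hα1
  set T := ψ b - ψ 0 with hT_def
  have hmem : ∀ z ∈ Icc 0 b, ψ z - ψ 0 ∈ Icc 0 T := fun z hz =>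
    ⟨sub_nonneg.2 (hψ_mono.monotoneOn h0b hz hz.1),
      sub_le_sub_right (hψ_mono.monotoneOn hz (right_mem_Icc.2 hb.le) hz.2) _⟩
  have hT : 0 ≤ T := (hmem b (right_mem_Icc.2 hb.le)).1
  have hsurj : ∀ s ∈ Icc 0 T, ∃ z ∈ Icc 0 b, ψ z - ψ 0 = s := fun s hs => by
    have h := intermediate_value_Icc hb.le (hψ_cont.sub continuousOn_const)
      (show s ∈ Icc (ψ 0 - ψ 0) (ψ b - ψ 0) by rwa [sub_self])
    exact h
  have hnW : ∀ z ∈ Icc 0 b, n z ≤ W₁ := fun z hz => (le_abs_self _).trans <| hW₁ ▸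
    le_csSup (isCompact_Icc.bddAbove_image hn_cont.abs) (mem_image_of_mem _ hz)
  have hkW : ∀ z ∈ Icc 0 b, k z ≤ W₂ := fun z hz => (le_abs_self _).trans <| hW₂ ▸
    le_csSup (isCompact_Icc.bddAbove_image hk_cont.abs) (mem_image_of_mem _ hz)
  have hW₁0 : 0 ≤ W₁ := (abs_nonneg (n 0)).trans <| hW₁ ▸
    le_csSup (isCompact_Icc.bddAbove_image hn_cont.abs) (mem_image_of_mem _ h0b)
  have hW₂0 : 0 ≤ W₂ := (abs_nonneg (k 0)).trans <| hW₂ ▸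
    le_csSup (isCompact_Icc.bddAbove_image hk_cont.abs) (mem_image_of_mem _ h0b)
  -- the Caputo derivative of a `C¹` function is continuous and inverted by `psiInt`
  have key : ∀ u u' : ℝ → ℝ, (∀ z ∈ Icc 0 b, HasDerivWithinAt u (u' z) (Icc 0 b) z) →
      ContinuousOn u' (Icc 0 b) → ∃ g : ℝ → ℝ, ContinuousOn g (Icc 0 T) ∧
        (∀ z ∈ Icc 0 b, psiCaputo α ψ ψ' u' z = g (ψ z - ψ 0)) ∧
        ∀ z ∈ Icc 0 b, u z - u 0 = 1 / Real.Gamma α * abelIntegral α g (ψ z - ψ 0) := by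
    intro u u' hu hu'
    obtain ⟨f, hf, hfu⟩ := exists_continuous_comp_sub_eq (h := fun κ => u' κ / ψ' κ)
      hψ_mono.injOn hψ_cont (hu'.div hψ'_cont fun z hz => (hψ'_pos z hz).ne')
    refine ⟨fun s => 1 / Real.Gamma (1 - α) * abelIntegral (1 - α) f s,
      ((continuousOn_abelIntegral hα1' hf).mono fun s hs => hs.1).const_smul
        (1 / Real.Gamma (1 - α)), fun z hz => ?_, fun z hz => ?_⟩
    · beta_reduce
      rw [← integral_kernel_eq_abelIntegral hψ_mono hψ_deriv hfu hz, psiCaputo]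
      have h1 : 1 - α - 1 = -α := by ring
      rw [h1]
    · rw [abelIntegral_const_mul, abelIntegral_abelIntegral hα0 hα1 hf (hmem z hz).1,
        ← integral_deriv_mul_comp_sub hψ_mono hψ_deriv f hz]
      have hsub : Icc 0 z ⊆ Icc 0 b := Icc_subset_Icc_right hz.2
      have h1 : ∫ κ in (0:ℝ)..z, ψ' κ * f (ψ κ - ψ 0) = ∫ κ in (0:ℝ)..z, u' κ := by
        refine intervalIntegral.integral_congr fun κ hκ => ?_
        rw [uIcc_of_le hz.1] at hκ
        rw [hfu κ (hsub hκ)]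
        exact mul_div_cancel₀ _ (hψ'_pos κ (hsub hκ)).ne'
      rw [h1, intervalIntegral.integral_eq_sub_of_hasDerivAt_of_le hz.1 (f := u)
        (fun κ hκ => (hu κ (hsub hκ)).continuousWithinAt.mono hsub)
        (fun κ hκ => (hu κ (hsub (Ioo_subset_Icc_self hκ))).hasDerivAt
          (Icc_mem_nhds hκ.1 (hκ.2.trans_le hz.2)))
        ((hu'.mono hsub).intervalIntegrable_of_Icc hz.1)]
      field_simp
  obtain ⟨K, hK, hgron⟩ := exists_bound_of_le_add_abelIntegral (β := α)
    (C := W₁ * (1 + W₂) * (1 / Real.Gamma α)) hα0 (by positivity) hT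
  obtain ⟨B, hB⟩ := isCompact_Icc.exists_bound_of_continuousOn
    ((continuousOn_abelIntegral hα0 (continuous_const (y := (1:ℝ)))).mono
      (fun s hs => hs.1 : Icc 0 T ⊆ Ici 0))
  have hB0 : 0 ≤ B := (norm_nonneg _).trans (hB 0 ⟨le_rfl, hT⟩)
  refine ⟨fun ε => 1 / Real.Gamma α * (K * ε * B), by fun_prop, fun x hx => ?_, by simp, ?_⟩
  · have hx' : 0 ≤ x := hx
    positivity
  intro ε hε ω ω' hω hω' hωε v v' hv hv' hvF h00 z hz
  obtain ⟨gω, hgω, hgωC, hgωI⟩ := key ω ω' hω hω'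
  obtain ⟨gv, hgv, hgvC, hgvI⟩ := key v v' hv hv'
  set G : ℝ → ℝ := fun s => |gω s - gv s| with hG_def
  have hG : ContinuousOn G (Icc 0 T) := (hgω.sub hgv).abs
  have hdiff : ∀ z ∈ Icc 0 b,
      |ω z - v z| ≤ 1 / Real.Gamma α * abelIntegral α G (ψ z - ψ 0) := fun z hz => by
    have hs := hmem z hz
    have hsub : Icc 0 (ψ z - ψ 0) ⊆ Icc 0 T := Icc_subset_Icc_right hs.2
    have h1 : ω z - v z =
        1 / Real.Gamma α * abelIntegral α (fun t => gω t - gv t) (ψ z - ψ 0) := by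
      rw [abelIntegral_sub hα0 hs.1 (hgω.mono hsub) (hgv.mono hsub), mul_sub, ← hgωI z hz,
        ← hgvI z hz, h00]
      ring
    rw [h1, abs_mul, abs_of_pos (one_div_pos.2 hΓ)]
    gcongr
    exact abs_abelIntegral_le hα0 hs.1 (hG.mono hsub) fun t _ => le_rfl
  have hH : ∀ u' g : ℝ → ℝ, ContinuousOn g (Icc 0 T) →
      (∀ z ∈ Icc 0 b, psiCaputo α ψ ψ' u' z = g (ψ z - ψ 0)) → ∀ z ∈ Icc 0 b,
      ContinuousOn (fun τ => H z τ (psiCaputo α ψ ψ' u' τ)) (Icc 0 b) := by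
    intro u' g hg hgC z hz
    have hc : ContinuousOn (fun τ => psiCaputo α ψ ψ' u' τ) (Icc 0 b) :=
      (hg.comp (hψ_cont.sub continuousOn_const) hmem).congr hgC
    exact hH_cont.comp (continuousOn_const.prodMk (continuousOn_id.prodMk hc))
      fun τ hτ => ⟨hz, hτ, mem_univ _⟩
  have hbound : ∀ s ∈ Icc 0 T,
      G s ≤ ε + W₁ * (1 + W₂) * (1 / Real.Gamma α) * abelIntegral α G s := by
    intro s hs
    obtain ⟨z, hz, rfl⟩ := hsurj s hs
    have hsub : Icc 0 (ψ z - ψ 0) ⊆ Icc 0 T := Icc_subset_Icc_right hs.2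
    obtain ⟨pω, hpω, hpωH⟩ := exists_continuous_comp_sub_eq hψ_mono.injOn hψ_cont
      (hH ω' gω hgω hgωC z hz)
    obtain ⟨pv, hpv, hpvH⟩ := exists_continuous_comp_sub_eq hψ_mono.injOn hψ_cont
      (hH v' gv hgv hgvC z hz)
    set Jω := psiInt α ψ ψ' (fun τ => H z τ (psiCaputo α ψ ψ' ω' τ)) z with hJω
    set Jv := psiInt α ψ ψ' (fun τ => H z τ (psiCaputo α ψ ψ' v' τ)) z with hJv
    have hJ : |Jω - Jv| ≤ W₂ * (1 / Real.Gamma α * abelIntegral α G (ψ z - ψ 0)) := by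
      rw [hJω, hJv, psiInt, psiInt,
        integral_kernel_eq_abelIntegral hψ_mono hψ_deriv hpωH hz,
        integral_kernel_eq_abelIntegral hψ_mono hψ_deriv hpvH hz, ← mul_sub,
        ← abelIntegral_sub hα0 hs.1 hpω.continuousOn hpv.continuousOn, abs_mul,
        abs_of_pos (one_div_pos.2 hΓ), mul_left_comm, ← abelIntegral_const_mul]
      gcongr
      refine abs_abelIntegral_le hα0 hs.1 ((hG.mono hsub).const_smul W₂) fun t ht => ?_
      obtain ⟨τ, hτ, rfl⟩ := hsurj t (hsub ht)
      rw [hpωH τ hτ, hpvH τ hτ]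
      refine (hQ2 z hz τ hτ _ _).trans ?_
      rw [hgωC τ hτ, hgvC τ hτ]
      exact mul_le_mul_of_nonneg_right (hkW z hz) (abs_nonneg _)
    have h1 := hωε z hz
    have h2 := hvF z hz
    have h3 := hQ1 z hz (ω z) Jω (v z) Jv
    have h4 : n z * (|ω z - v z| + |Jω - Jv|) ≤ W₁ * (|ω z - v z| + |Jω - Jv|) :=
      mul_le_mul_of_nonneg_right (hnW z hz) (by positivity)
    have h5 : W₁ * (|ω z - v z| + |Jω - Jv|) ≤
        W₁ * (1 / Real.Gamma α * abelIntegral α G (ψ z - ψ 0) +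
          W₂ * (1 / Real.Gamma α * abelIntegral α G (ψ z - ψ 0))) := by
      gcongr
      exact hdiff z hz
    rw [hgωC z hz] at h1
    rw [hgvC z hz] at h2
    have h6 : G (ψ z - ψ 0) ≤ ε + |F z (ω z) Jω - F z (v z) Jv| := by
      simp only [hG_def]
      rw [h2]
      exact (abs_sub_le _ (F z (ω z) Jω) _).trans (add_le_add_left h1 _)
    calc G (ψ z - ψ 0) ≤ ε + W₁ * (1 / Real.Gamma α * abelIntegral α G (ψ z - ψ 0) +
          W₂ * (1 / Real.Gamma α * abelIntegral α G (ψ z - ψ 0))) := by linarith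
      _ = _ := by ring
  have hGK := hgron ε G hε.le hG hbound
  have hs := hmem z hz
  refine (hdiff z hz).trans ?_
  have h1 : abelIntegral α G (ψ z - ψ 0) ≤
      K * ε * abelIntegral α (fun _ => (1:ℝ)) (ψ z - ψ 0) := by
    rw [← abelIntegral_const_mul]
    refine (le_abs_self _).trans (abs_abelIntegral_le hα0 hs.1 (by fun_prop) fun t ht => ?_)
    rw [mul_one, abs_of_nonneg (abs_nonneg _)]
    exact hGK t ⟨ht.1, ht.2.trans hs.2⟩
  have h2 := (le_abs_self _).trans (hB _ hs)
  beta_reduce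
  gcongr
  exact h1.trans (by gcongr)
end
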